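/- arXiv:2205.12826 — 3 statements merged into one kernel-verified Lean document; each statement's English description precedes it below -/
import Mathlib

section
/- For every integer s ≥ 2, there exists a finite simple graph G such that every 2-colouring of the edges of G contains a monochromatic triangle (i.e. G →₂ K₃), but there exists a 2-colouring of the edges of the s-blowup G[s] containing no monochromatic canonical copy of K₃[2]. -/
/-- `Arrows G H r` : every `r`-colouring of the edges of `G` contains a
monochromatic copy of `H` (an injective graph homomorphism from `H` into `G`
all of whose edges receive the same colour). -/
def Arrows {α β : Type*} (G : SimpleGraph α) (H : SimpleGraph β) (r : ℕ) : Prop :=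
  ∀ c : Sym2 α → Fin r, ∃ f : β → α, Function.Injective f ∧
    ∃ k : Fin r, ∀ u v : β, H.Adj u v → G.Adj (f u) (f v) ∧ c s(f u, f v) = k

/-- `HasMonoCanonCopy G H n t r c` : the colouring `c` of the edges of the
`n`-blowup `G[n]` (whose vertex set is `α × Fin n`, with `(u,i)` adjacent to
`(v,j)` iff `u ~ v` in `G`) contains a monochromatic canonical copy of the
`t`-blowup `H[t]`: there is a copy `f` of `H` in `G` and, for each vertex `u`
of `H`, a `t`-subset of the blowup of `f u`, such that all edges of the
corresponding copy of `H[t]` get the same colour. -/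
def HasMonoCanonCopy {α β : Type*} (G : SimpleGraph α) (H : SimpleGraph β)
    (n t r : ℕ) (c : Sym2 (α × Fin n) → Fin r) : Prop :=
  ∃ f : β → α, Function.Injective f ∧
    ∃ g : β → Fin t → Fin n, (∀ u, Function.Injective (g u)) ∧
      ∃ k : Fin r, ∀ u v : β, H.Adj u v →
        G.Adj (f u) (f v) ∧ ∀ i j, c s((f u, g u i), (f v, g v j)) = k

open Combinatorics

/-- Every edge and every triangle of the partitioned graph `(H, q)` lies over the same parts as some
edge, respectively triangle, of `(G, p)`. -/
structure LocallyOver {I V W : Type} (H : SimpleGraph W) (q : W → I) (G : SimpleGraph V)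
    (p : V → I) : Prop where
  edge : ∀ a b, H.Adj a b → ∃ u v, G.Adj u v ∧ p u = q a ∧ p v = q b
  triangle : ∀ a b c, H.Adj a b → H.Adj b c → H.Adj a c →
    ∃ u v w, G.Adj u v ∧ G.Adj v w ∧ G.Adj u w ∧ p u = q a ∧ p v = q b ∧ p w = q c

namespace LocallyOver

variable {I U V W : Type}

lemma refl (G : SimpleGraph V) (p : V → I) : LocallyOver G p G p :=
  ⟨fun a b h => ⟨a, b, h, rfl, rfl⟩,
    fun a b c h₁ h₂ h₃ => ⟨a, b, c, h₁, h₂, h₃, rfl, rfl, rfl⟩⟩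

lemma trans {K : SimpleGraph U} {r : U → I} {H : SimpleGraph W} {q : W → I} {G : SimpleGraph V}
    {p : V → I} (h : LocallyOver K r H q) (h' : LocallyOver H q G p) : LocallyOver K r G p := by
  constructor
  · intro a b hab
    obtain ⟨u, v, huv, hu, hv⟩ := h.edge a b hab
    obtain ⟨x, y, hxy, hx, hy⟩ := h'.edge u v huv
    exact ⟨x, y, hxy, hx.trans hu, hy.trans hv⟩
  · intro a b c hab hbc hac
    obtain ⟨u, v, w, huv, hvw, huw, hu, hv, hw⟩ := h.triangle a b c hab hbc hac
    obtain ⟨x, y, z, hxy, hyz, hxz, hx, hy, hz⟩ := h'.triangle u v w huv hvw huw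
    exact ⟨x, y, z, hxy, hyz, hxz, hx.trans hu, hy.trans hv, hz.trans hw⟩

end LocallyOver

/-! ### The partite construction -/

section Amplification

variable {I V ι : Type} {G : SimpleGraph V} {p : V → I} {i j : I}

/-- The edges of `G` from the part `i` to the part `j`. -/
abbrev CrossEdge (G : SimpleGraph V) (p : V → I) (i j : I) : Type :=
  {d : V × V // G.Adj d.1 d.2 ∧ p d.1 = i ∧ p d.2 = j}

open Classical in
/-- Replace the vertices in the parts `i` and `j` by the endpoints of a given edge, if any. -/
noncomputable def fillVertex : Option (CrossEdge G p i j) → V → V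
  | none, v => v
  | some d, v => if p v = i then d.1.1 else if p v = j then d.1.2 else v

lemma part_fillVertex (o : Option (CrossEdge G p i j)) (v : V) : p (fillVertex o v) = p v := by
  rcases o with _ | ⟨d, hd, h₁, h₂⟩
  · rfl
  · simp only [fillVertex]
    split_ifs <;> simp_all

lemma adj_fillVertex (hp : ∀ u v, G.Adj u v → p u ≠ p v) (o : Option (CrossEdge G p i j))
    {u v : V} (huv : G.Adj u v) (hu : p u = i ∨ p u = j) (hv : p v = i ∨ p v = j) :
    G.Adj (fillVertex o u) (fillVertex o v) := by
  have hne := hp u v huv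
  rcases o with _ | ⟨d, hd, h₁, h₂⟩
  · exact huv
  · rcases hu with hu | hu <;> rcases hv with hv | hv
    · exact absurd (hu.trans hv.symm) hne
    · have hji : j ≠ i := fun h => hne (by rw [hu, hv, h])
      simpa [fillVertex, hu, hv, hji] using hd
    · have hji : j ≠ i := fun h => hne (by rw [hu, hv, h])
      simpa [fillVertex, hu, hv, hji] using hd.symm
    · exact absurd (hu.trans hv.symm) hne

open Classical in
/-- The copy of the vertex set of `G` given by a combinatorial line of cross edges. The copies of
the parts `i` and `j` live in a common cube, those of the other parts are pairwise disjoint. -/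
noncomputable def lineCopy (L : Line (CrossEdge G p i j) ι) (v : V) :
    I × Option (Line (CrossEdge G p i j) ι) × (ι → V) :=
  (p v, if p v = i ∨ p v = j then none else some L, fun t => fillVertex (L.idxFun t) v)

/-- The union of the copies of `G` given by all combinatorial lines of cross edges. -/
def amplify (hp : ∀ u v, G.Adj u v → p u ≠ p v) (i j : I) (ι : Type) :
    SimpleGraph (I × Option (Line (CrossEdge G p i j) ι) × (ι → V)) where
  Adj a b := ∃ L u v, G.Adj u v ∧ lineCopy L u = a ∧ lineCopy L v = b
  symm := ⟨fun _ _ ⟨L, u, v, h, hu, hv⟩ => ⟨L, v, u, h.symm, hv, hu⟩⟩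
  loopless := ⟨fun _ ⟨_, u, v, h, hu, hv⟩ => hp u v h (congrArg Prod.fst (hu.trans hv.symm))⟩

lemma lineCopy_line_eq {L M : Line (CrossEdge G p i j) ι} {v : V}
    (hv : ¬(p v = i ∨ p v = j)) (h : (lineCopy L v).2.1 = some M) : L = M := by
  simpa [lineCopy, hv] using h

lemma exists_line_of_adj {hp : ∀ u v, G.Adj u v → p u ≠ p v}
    {a b : I × Option (Line (CrossEdge G p i j) ι) × (ι → V)}
    (hab : (amplify hp i j ι).Adj a b) (ha : ¬(a.1 = i ∨ a.1 = j)) :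
    ∃ L, a.2.1 = some L ∧ ((b.1 = i ∨ b.1 = j) ∨ b.2.1 = some L) := by
  obtain ⟨L, u, v, -, rfl, rfl⟩ := hab
  refine ⟨L, if_neg ha, ?_⟩
  by_cases hv : p v = i ∨ p v = j
  · exact Or.inl hv
  · exact Or.inr (if_neg hv)

/-- Projecting to an active coordinate of `L` maps an edge to an edge, unless the edge belongs to
the copy given by another line and leaves the parts `i` and `j`. -/
lemma adj_proj {hp : ∀ u v, G.Adj u v → p u ≠ p v}
    {a b : I × Option (Line (CrossEdge G p i j) ι) × (ι → V)}
    (hab : (amplify hp i j ι).Adj a b) {L : Line (CrossEdge G p i j) ι} {t : ι}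
    (ht : L.idxFun t = none) (ha : (a.1 = i ∨ a.1 = j) ∨ a.2.1 = some L)
    (hb : (b.1 = i ∨ b.1 = j) ∨ b.2.1 = some L) : G.Adj (a.2.2 t) (b.2.2 t) := by
  obtain ⟨M, u, v, huv, rfl, rfl⟩ := hab
  have key (h : M = L) : G.Adj ((lineCopy M u).2.2 t) ((lineCopy M v).2.2 t) := by
    subst h
    simpa [lineCopy, ht, fillVertex] using huv
  by_cases hu : p u = i ∨ p u = j
  · by_cases hv : p v = i ∨ p v = j
    · exact adj_fillVertex hp _ huv hu hv
    · exact key (lineCopy_line_eq hv (hb.resolve_left hv))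
  · exact key (lineCopy_line_eq hu (ha.resolve_left hu))

lemma part_proj {hp : ∀ u v, G.Adj u v → p u ≠ p v}
    {a b : I × Option (Line (CrossEdge G p i j) ι) × (ι → V)}
    (hab : (amplify hp i j ι).Adj a b) (t : ι) : p (a.2.2 t) = a.1 := by
  obtain ⟨M, u, v, -, rfl, -⟩ := hab
  exact part_fillVertex _ _

lemma triangle_of_part_ne {hp : ∀ u v, G.Adj u v → p u ≠ p v}
    {a b c : I × Option (Line (CrossEdge G p i j) ι) × (ι → V)}
    (hab : (amplify hp i j ι).Adj a b) (hbc : (amplify hp i j ι).Adj b c)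
    (hac : (amplify hp i j ι).Adj a c) (ha : ¬(a.1 = i ∨ a.1 = j)) :
    ∃ u v w, G.Adj u v ∧ G.Adj v w ∧ G.Adj u w ∧ p u = a.1 ∧ p v = b.1 ∧ p w = c.1 := by
  obtain ⟨L, haL, hb⟩ := exists_line_of_adj hab ha
  obtain ⟨M, haM, hc⟩ := exists_line_of_adj hac ha
  obtain rfl : L = M := Option.some_injective _ (haL.symm.trans haM)
  obtain ⟨t, ht⟩ := L.proper
  exact ⟨_, _, _, adj_proj hab ht (.inr haL) hb, adj_proj hbc ht hb hc,
    adj_proj hac ht (.inr haL) hc, part_proj hab t, part_proj hbc t, part_proj hac.symm t⟩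

lemma amplify_locallyOver (hp : ∀ u v, G.Adj u v → p u ≠ p v) (i j : I) (ι : Type) :
    LocallyOver (amplify hp i j ι) Prod.fst G p := by
  constructor
  · rintro _ _ ⟨L, u, v, huv, rfl, rfl⟩
    exact ⟨u, v, huv, rfl, rfl⟩
  · intro a b c hab hbc hac
    have part_ne {x y} (h : (amplify hp i j ι).Adj x y) : x.1 ≠ y.1 := by
      obtain ⟨L, u, v, huv, rfl, rfl⟩ := h
      exact hp u v huv
    by_cases ha : a.1 = i ∨ a.1 = j
    · by_cases hb : b.1 = i ∨ b.1 = j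
      · have hc : ¬(c.1 = i ∨ c.1 = j) := by
          have h₁ := part_ne hab
          have h₂ := part_ne hbc
          have h₃ := part_ne hac
          grind
        obtain ⟨w, u, v, h₁, h₂, h₃, hw, hu, hv⟩ := triangle_of_part_ne hac.symm hab hbc.symm hc
        exact ⟨u, v, w, h₂, h₃.symm, h₁.symm, hu, hv, hw⟩
      · obtain ⟨v, u, w, h₁, h₂, h₃, hv, hu, hw⟩ := triangle_of_part_ne hab.symm hac hbc hb
        exact ⟨u, v, w, h₁.symm, h₃, h₂, hu, hv, hw⟩
    · exact triangle_of_part_ne hab hbc hac ha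

end Amplification

/-- A finite partitioned graph can be amplified, without creating new kinds of triangles, so that
every `2`-colouring contains a copy of the original graph all of whose edges from the part `i` to
the part `j` have the same colour. -/
lemma exists_amplification {I V : Type} [Finite I] [Finite V] {G : SimpleGraph V} {p : V → I}
    (hp : ∀ u v, G.Adj u v → p u ≠ p v) (i j : I) :
    ∃ (W : Type) (_ : Finite W) (H : SimpleGraph W) (q : W → I), LocallyOver H q G p ∧
      ∀ c : Sym2 W → Fin 2, ∃ φ : V → W, (∀ v, q (φ v) = p v) ∧
        (∀ u v, G.Adj u v → H.Adj (φ u) (φ v)) ∧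
        ∃ k, ∀ u v, G.Adj u v → p u = i → p v = j → c s(φ u, φ v) = k := by
  obtain ⟨ι, _, hι⟩ := Line.exists_mono_in_high_dimension (CrossEdge G p i j) (Fin 2)
  have : Finite (Line (CrossEdge G p i j) ι) :=
    Finite.of_injective Line.idxFun fun _ _ => Line.ext
  refine ⟨_, inferInstance, amplify hp i j ι, Prod.fst, amplify_locallyOver hp i j ι, fun c => ?_⟩
  obtain ⟨L, k, hL⟩ := hι fun w => c s((i, none, fun t => (w t).1.1), (j, none, fun t => (w t).1.2))
  refine ⟨lineCopy L, fun v => rfl, fun u v h => ⟨L, u, v, h, rfl, rfl⟩, k, ?_⟩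
  intro u v huv hu hv
  have hji : j ≠ i := fun h => hp u v huv (by rw [hu, hv, h])
  rw [← hL ⟨(u, v), huv, hu, hv⟩]
  congr 2
  · simp only [lineCopy, hu, true_or, if_true, Prod.mk.injEq, true_and]
    funext t
    rcases h : L.idxFun t with _ | d <;> simp [h, fillVertex, hu]
  · simp only [lineCopy, hv, or_true, if_true, Prod.mk.injEq, true_and]
    funext t
    rcases h : L.idxFun t with _ | d <;> simp [h, fillVertex, hv, hji]

/-- A finite partitioned graph can be amplified, without creating new kinds of triangles, so that
every `2`-colouring contains a copy of the original graph in which the colour of an edge depends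
only on the parts of its endpoints. -/
lemma exists_partite_ramsey {I V : Type} [Finite I] [Finite V] (G : SimpleGraph V) (p : V → I)
    (hp : ∀ u v, G.Adj u v → p u ≠ p v) :
    ∃ (W : Type) (_ : Finite W) (H : SimpleGraph W) (q : W → I), LocallyOver H q G p ∧
      ∀ c : Sym2 W → Fin 2, ∃ φ : V → W, (∀ v, q (φ v) = p v) ∧
        (∀ u v, G.Adj u v → H.Adj (φ u) (φ v)) ∧
        ∃ χ : I → I → Fin 2, ∀ u v, G.Adj u v → c s(φ u, φ v) = χ (p u) (p v) := by
  classical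
  cases nonempty_fintype I
  suffices h : ∀ D : Finset (I × I),
      ∃ (W : Type) (_ : Finite W) (H : SimpleGraph W) (q : W → I), LocallyOver H q G p ∧
        ∀ c : Sym2 W → Fin 2, ∃ φ : V → W, (∀ v, q (φ v) = p v) ∧
          (∀ u v, G.Adj u v → H.Adj (φ u) (φ v)) ∧
          ∃ χ : I → I → Fin 2, ∀ u v, G.Adj u v → (p u, p v) ∈ D →
            c s(φ u, φ v) = χ (p u) (p v) by
    simpa using h Finset.univ
  intro D
  induction D using Finset.induction_on with
  | empty =>
    exact ⟨V, inferInstance, G, p, .refl G p,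
      fun c => ⟨id, fun _ => rfl, fun _ _ h => h, fun _ _ => 0, by simp⟩⟩
  | insert e D he ih =>
    obtain ⟨W, _, H, q, hH, hc⟩ := ih
    have hq : ∀ u v, H.Adj u v → q u ≠ q v := by
      intro a b hab
      obtain ⟨u, v, huv, hu, hv⟩ := hH.edge a b hab
      exact hu ▸ hv ▸ hp u v huv
    obtain ⟨W', hW', H', q', hH', hc'⟩ := exists_amplification hq e.1 e.2
    refine ⟨W', hW', H', q', hH'.trans hH, fun c => ?_⟩
    obtain ⟨ψ, hψq, hψ, k, hk⟩ := hc' c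
    obtain ⟨φ, hφq, hφ, χ, hχ⟩ := hc fun d => c (d.map ψ)
    refine ⟨ψ ∘ φ, fun v => (hψq _).trans (hφq v), fun u v h => hψ _ _ (hφ u v h),
      fun x y => if (x, y) = e then k else χ x y, fun u v huv hD => ?_⟩
    dsimp only
    split_ifs with h
    · subst h
      exact hk _ _ (hφ u v huv) (hφq u) (hφq v)
    · exact hχ u v huv ((Finset.mem_insert.1 hD).resolve_left h)

/-! ### Ramsey's theorem for triangles -/

lemma exists_mono_triple_of_card {κ : Type*} [DecidableEq κ] (n : ℕ) :
    ∃ M : ℕ, ∀ (S : Finset ℕ) (K : Finset κ) (c : ℕ → ℕ → κ), M ≤ S.card → K.card ≤ n →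
      (∀ x ∈ S, ∀ y ∈ S, x < y → c x y ∈ K) →
      ∃ x ∈ S, ∃ y ∈ S, ∃ z ∈ S, x < y ∧ y < z ∧ c x y = c y z ∧ c x y = c x z := by
  induction n with
  | zero =>
    refine ⟨2, fun S K c hS hK hc => ?_⟩
    obtain ⟨x, hx, y, hy, hxy⟩ := Finset.one_lt_card.1 hS
    have hK : K = ∅ := by simpa using hK
    rcases hxy.lt_or_gt with h | h
    · simpa [hK] using hc x hx y hy h
    · simpa [hK] using hc y hy x hx h
  | succ n ih =>
    obtain ⟨M, hM⟩ := ih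
    refine ⟨(n + 1) * M + 2, fun S K c hS hK hc => ?_⟩
    have hne : S.Nonempty := Finset.card_pos.1 (by omega)
    set m := S.min' hne
    have hm : m ∈ S := S.min'_mem hne
    have hlt : ∀ x ∈ S.erase m, m < x := fun x hx => S.min'_lt_of_mem_erase_min' hne hx
    obtain ⟨k, hk, hcard⟩ := Finset.exists_lt_card_fiber_of_mul_lt_card_of_maps_to
      (s := S.erase m) (t := K) (f := c m) (n := M)
      (fun x hx => hc m hm x (Finset.mem_of_mem_erase hx) (hlt x hx))
      (by
        rw [Finset.card_erase_of_mem hm]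
        have := Nat.mul_le_mul_right M hK
        omega)
    set T := {x ∈ S.erase m | c m x = k}
    have hTS : ∀ x ∈ T, x ∈ S ∧ m < x ∧ c m x = k := fun x hx => by
      obtain ⟨h₁, h₂⟩ := Finset.mem_filter.1 hx
      exact ⟨Finset.mem_of_mem_erase h₁, hlt x h₁, h₂⟩
    by_cases h : ∃ x ∈ T, ∃ y ∈ T, x < y ∧ c x y = k
    · obtain ⟨x, hx, y, hy, hxy, hk⟩ := h
      obtain ⟨hxS, hmx, hcx⟩ := hTS x hx
      obtain ⟨hyS, -, hcy⟩ := hTS y hy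
      exact ⟨m, hm, x, hxS, y, hyS, hmx, hxy, hcx.trans hk.symm, hcx.trans hcy.symm⟩
    · push Not at h
      obtain ⟨x, hx, y, hy, z, hz, hxyz⟩ := hM T (K.erase k) c hcard.le
        (by rw [Finset.card_erase_of_mem hk]; omega)
        (fun x hx y hy hxy => Finset.mem_erase.2
          ⟨h x hx y hy hxy, hc x (hTS x hx).1 y (hTS y hy).1 hxy⟩)
      exact ⟨x, (hTS x hx).1, y, (hTS y hy).1, z, (hTS z hz).1, hxyz⟩

lemma exists_mono_triple (κ : Type*) [Finite κ] :
    ∃ M : ℕ, ∀ c : Fin M → Fin M → κ,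
      ∃ x y z, x < y ∧ y < z ∧ c x y = c y z ∧ c x y = c x z := by
  classical
  cases nonempty_fintype κ
  obtain ⟨M, hM⟩ := exists_mono_triple_of_card (κ := κ) (Fintype.card κ)
  refine ⟨M + 1, fun c => ?_⟩
  obtain ⟨x, hx, y, hy, z, hz, hxy, hyz, h₁, h₂⟩ := hM (Finset.range (M + 1)) Finset.univ
    (fun x y => c (Fin.ofNat (M + 1) x) (Fin.ofNat (M + 1) y)) (by simp) le_rfl (by simp)
  refine ⟨_, _, _, ?_, ?_, h₁, h₂⟩ <;>
  · simp only [Finset.mem_range] at hx hy hz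
    simpa [Fin.lt_def, Nat.mod_eq_of_lt, hx, hy, hz]

/-! ### The template of labels -/

/-- Three edge labels `F`, `H`, `K` on the pairs `xy`, `yz`, `xz` with `x < y < z`, where the colour
of an edge of the blowup is the label evaluated at the smaller endpoint, are allowed if they produce
no monochromatic copy of the `2`-blowup of the triangle `xyz`. -/
def AllowedLabels {S : Type*} (F H K : S → Bool) : Prop :=
  ∀ (k : Bool) (a a' b b' : S), a ≠ a' → b ≠ b' →
    ¬(F a = k ∧ F a' = k ∧ K a = k ∧ K a' = k ∧ H b = k ∧ H b' = k)

lemma allowedLabels_const {S : Type*} (e : Bool) (K : S → Bool) :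
    AllowedLabels (fun _ => e) (fun _ => !e) K := by
  rintro k a a' b b' - - ⟨rfl, -, -, -, h, -⟩
  simp at h

lemma allowedLabels_threshold {s : ℕ} (t : ℕ) (e : Bool) :
    AllowedLabels (fun a : Fin s => xor (decide (a.1 < t)) (!e)) (fun _ => !e)
      (fun a : Fin s => xor (decide (a.1 < t + 1)) e) := by
  rintro k a a' b b' ha - ⟨h₁, h₂, h₃, h₄, rfl, -⟩
  apply ha
  ext
  cases e <;> simp at h₁ h₂ h₃ h₄ <;> omega

/-- The indices of the template: an apex (`none`), a root (`some none`) and a family of leaves. -/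
abbrev TemplateIndex (s : ℕ) : Type := Option (Option (Fin (s + 1) × Bool))

/-- The edge labels of the template. -/
def templateLabel {s : ℕ} : TemplateIndex s → TemplateIndex s → Fin s → Bool
  | none, _ => fun _ => true
  | some _, none => fun _ => false
  | some none, some none => fun _ => true
  | some none, some (some (t, e)) => fun a => xor (decide (a.1 < t.1)) e
  | some (some _), some none => fun _ => true
  | some (some y), some (some z) => fun _ => if y = z then true else y.2

/-- Every `2`-colouring of the template has a monochromatic allowed triple. -/
lemma exists_mono_allowed_template {s : ℕ} (c : TemplateIndex s → TemplateIndex s → Fin 2) :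
    ∃ x y z, AllowedLabels (templateLabel x y) (templateLabel y z) (templateLabel x z) ∧
      c x y = c y z ∧ c x y = c x z := by
  by_contra! h
  have fin_two {k l m : Fin 2} (h₁ : k ≠ l) (h₂ : m ≠ l) : k = m := by omega
  have self_label (x : TemplateIndex s) : templateLabel x x = fun _ => true := by
    rcases x with _ | _ | _ <;> simp [templateLabel]
  have diag_ne (x y) (hxy : templateLabel x y = fun _ => false) : c x x ≠ c x y := fun hc =>
    h x x y (by rw [self_label, hxy]; exact allowedLabels_const true _) hc hc
  have some_none (x : Option (Fin (s + 1) × Bool)) :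
      templateLabel (some x) none = fun _ : Fin s => false := by
    cases x <;> rfl
  have apex_ne (x : Option (Fin (s + 1) × Bool)) : c (some x) none ≠ c none none := fun hc =>
    h (some x) none none
      (by rw [some_none, self_label]; exact allowedLabels_const false _) hc rfl
  have const_true (x y : Option (Fin (s + 1) × Bool))
      (hxy : templateLabel (some x) (some y) = fun _ => true) :
      c (some x) (some y) = c none none := by
    have hne : c (some x) (some y) ≠ c (some y) none := fun hc =>
      h (some x) (some y) none (by rw [hxy, some_none]; exact allowedLabels_const true _) hc
        (hc.trans (fin_two (apex_ne y) (apex_ne x)))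
    exact fin_two hne (apex_ne y).symm
  have const_false (x y : Option (Fin (s + 1) × Bool))
      (hxy : templateLabel (some x) (some y) = fun _ => false) :
      c (some x) (some y) ≠ c none none := by
    rw [← const_true x x (self_label _)]
    exact (diag_ne _ _ hxy).symm
  have const_iff (x y : Option (Fin (s + 1) × Bool)) (e : Bool)
      (hxy : templateLabel (some x) (some y) = fun _ => e) :
      c (some x) (some y) = c none none ↔ e = true := by
    cases e
    · simpa using const_false x y hxy
    · simpa using const_true x y hxy
  have root_iff (t : ℕ) : ∀ (ht : t < s + 1) (e : Bool),
      c (some none) (some (some (⟨t, ht⟩, e))) = c none none ↔ e = true := by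
    induction t with
    | zero =>
      intro ht e
      exact const_iff _ _ _ (by funext a; simp [templateLabel])
    | succ t ih =>
      intro ht e
      have h₁ := ih (by omega) (!e)
      have hlab : templateLabel (some (some (⟨t, by omega⟩, !e))) (some (some (⟨t + 1, ht⟩, e))) =
          fun _ : Fin s => !e := by
        funext a
        simp [templateLabel]
      have h₂ := const_iff _ _ _ hlab
      have h₃ := h (some none) (some (some (⟨t, by omega⟩, !e))) (some (some (⟨t + 1, ht⟩, e)))
        (by rw [hlab]; exact allowedLabels_threshold t e)
      cases e <;> simp at h₁ h₂ h₃ ⊢ <;> omega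
  have h₁ := (root_iff s (by omega) true).2 rfl
  refine const_false _ _ ?_ h₁
  funext a
  simp [templateLabel]

/-! ### The graph and the colouring of its blowup -/

/-- The triples of parts, with increasing first coordinates, whose template labels are allowed. -/
abbrev AllowedTriple (M s : ℕ) : Type :=
  {τ : Fin 3 → Fin M × TemplateIndex s // StrictMono (fun n => (τ n).1) ∧
    AllowedLabels (templateLabel (τ 0).2 (τ 1).2) (templateLabel (τ 1).2 (τ 2).2)
      (templateLabel (τ 0).2 (τ 2).2)}

/-- The disjoint union of triangles, one for each allowed triple of parts. -/
def triangleUnion (M s : ℕ) : SimpleGraph (AllowedTriple M s × Fin 3) where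
  Adj a b := a.1 = b.1 ∧ a.2 ≠ b.2
  symm := ⟨fun _ _ h => ⟨h.1.symm, h.2.symm⟩⟩
  loopless := ⟨fun _ h => h.2 rfl⟩

/-- The part of a vertex of `triangleUnion`. -/
def trianglePart {M s : ℕ} (a : AllowedTriple M s × Fin 3) : Fin M × TemplateIndex s :=
  a.1.1 a.2

lemma trianglePart_fst_ne {M s : ℕ} {a b : AllowedTriple M s × Fin 3}
    (h : (triangleUnion M s).Adj a b) : (trianglePart a).1 ≠ (trianglePart b).1 := by
  obtain ⟨τ, m⟩ := a
  obtain ⟨σ, n⟩ := b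
  obtain ⟨rfl, hmn⟩ := h
  exact fun h => hmn (τ.2.1.injective h)

lemma allowed_of_triangleUnion {M s : ℕ} {a b c : AllowedTriple M s × Fin 3}
    (hab : (triangleUnion M s).Adj a b) (hbc : (triangleUnion M s).Adj b c)
    (h₁ : (trianglePart a).1 < (trianglePart b).1)
    (h₂ : (trianglePart b).1 < (trianglePart c).1) :
    AllowedLabels (templateLabel (trianglePart a).2 (trianglePart b).2)
      (templateLabel (trianglePart b).2 (trianglePart c).2)
      (templateLabel (trianglePart a).2 (trianglePart c).2) := by
  obtain ⟨τ, l⟩ := a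
  obtain ⟨τ', m⟩ := b
  obtain ⟨τ'', n⟩ := c
  obtain ⟨rfl, -⟩ : τ = τ' ∧ _ := hab
  obtain ⟨rfl, -⟩ : τ = τ'' ∧ _ := hbc
  have hlm : l < m := τ.2.1.lt_iff_lt.1 h₁
  have hmn : m < n := τ.2.1.lt_iff_lt.1 h₂
  obtain ⟨rfl, rfl, rfl⟩ : l = 0 ∧ m = 1 ∧ n = 2 := by omega
  exact τ.2.2

/-- The colouring of the blowup of a partitioned graph determined by the template labels. -/
def blowupColouring {W : Type} {M s : ℕ} (q : W → Fin M × TemplateIndex s) :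
    Sym2 (W × Fin s) → Fin 2 :=
  Sym2.lift ⟨fun a b =>
    if (q a.1).1 < (q b.1).1 then finTwoEquiv.symm (templateLabel (q a.1).2 (q b.1).2 a.2)
    else if (q b.1).1 < (q a.1).1 then finTwoEquiv.symm (templateLabel (q b.1).2 (q a.1).2 b.2)
    else 0, fun a b => by
      rcases lt_trichotomy (q a.1).1 (q b.1).1 with h | h | h
      · simp [h, h.not_gt]
      · simp [h]
      · simp [h, h.not_gt]⟩

lemma templateLabel_eq_of_blowupColouring {W : Type} {M s : ℕ} {q : W → Fin M × TemplateIndex s}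
    {u v : W} {a b : Fin s} {k : Fin 2} (h : (q u).1 < (q v).1)
    (hk : blowupColouring q s((u, a), (v, b)) = k) :
    templateLabel (q u).2 (q v).2 a = finTwoEquiv k := by
  rw [← Equiv.symm_apply_eq]
  simpa [blowupColouring, h] using hk

lemma not_hasMonoCanonCopy_blowupColouring {W : Type} {M s : ℕ} {H : SimpleGraph W}
    {q : W → Fin M × TemplateIndex s} (hH : LocallyOver H q (triangleUnion M s) trianglePart) :
    ¬HasMonoCanonCopy H (⊤ : SimpleGraph (Fin 3)) s 2 2 (blowupColouring q) := by
  rintro ⟨f, -, g, hg, k, hk⟩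
  have hadj {m n : Fin 3} (h : m ≠ n) : H.Adj (f m) (f n) := (hk m n h).1
  have hinj : Function.Injective fun n => (q (f n)).1 := by
    intro m n hmn
    by_contra hne
    obtain ⟨u, v, huv, hu, hv⟩ := hH.edge _ _ (hadj hne)
    exact trianglePart_fst_ne huv (by rw [hu, hv]; exact hmn)
  let σ := Tuple.sort fun n => (q (f n)).1
  have hmono : StrictMono fun n => (q (f (σ n))).1 :=
    (Tuple.monotone_sort fun n => (q (f n)).1).strictMono_of_injective
      (hinj.comp σ.injective)
  have hσ {m n : Fin 3} (h : m ≠ n) : σ m ≠ σ n := σ.injective.ne h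
  have h01 : (0 : Fin 3) ≠ 1 := by decide
  have h12 : (1 : Fin 3) ≠ 2 := by decide
  have h02 : (0 : Fin 3) ≠ 2 := by decide
  have hlt {m n : Fin 3} (h : m < n) : (q (f (σ m))).1 < (q (f (σ n))).1 := hmono h
  have lt01 := hlt (m := 0) (n := 1) (by decide)
  have lt12 := hlt (m := 1) (n := 2) (by decide)
  have lt02 := hlt (m := 0) (n := 2) (by decide)
  obtain ⟨u, v, w, huv, hvw, -, hu, hv, hw⟩ :=
    hH.triangle _ _ _ (hadj (hσ h01)) (hadj (hσ h12)) (hadj (hσ h02))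
  have hallowed := allowed_of_triangleUnion huv hvw (by rwa [hu, hv]) (by rwa [hv, hw])
  rw [hu, hv, hw] at hallowed
  have hcol {m n : Fin 3} (h : m ≠ n) (l : Fin 2) := (hk (σ m) (σ n) (hσ h)).2 l 0
  exact hallowed (finTwoEquiv k) (g (σ 0) 0) (g (σ 0) 1) (g (σ 1) 0) (g (σ 1) 1)
    ((hg _).ne (by decide)) ((hg _).ne (by decide))
    ⟨templateLabel_eq_of_blowupColouring lt01 (hcol h01 0),
      templateLabel_eq_of_blowupColouring lt01 (hcol h01 1),
      templateLabel_eq_of_blowupColouring lt02 (hcol h02 0),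
      templateLabel_eq_of_blowupColouring lt02 (hcol h02 1),
      templateLabel_eq_of_blowupColouring lt12 (hcol h12 0),
      templateLabel_eq_of_blowupColouring lt12 (hcol h12 1)⟩

lemma arrows_triangle_of_forall {α : Type*} {G : SimpleGraph α} {r : ℕ}
    (h : ∀ c : Sym2 α → Fin r, ∃ x y z, G.Adj x y ∧ G.Adj y z ∧ G.Adj x z ∧
      c s(x, y) = c s(y, z) ∧ c s(x, y) = c s(x, z)) :
    Arrows G (⊤ : SimpleGraph (Fin 3)) r := by
  intro c
  obtain ⟨x, y, z, hxy, hyz, hxz, h₁, h₂⟩ := h c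
  have key : ∀ u v : Fin 3, u ≠ v →
      G.Adj (![x, y, z] u) (![x, y, z] v) ∧ c s(![x, y, z] u, ![x, y, z] v) = c s(x, y) := by
    intro u v huv
    fin_cases u <;> fin_cases v <;>
      simp_all [Sym2.eq_swap, G.adj_comm]
  refine ⟨![x, y, z], fun u v huv => ?_, c s(x, y), key⟩
  by_contra hne
  exact (key u v hne).1.ne huv

/-- The main theorem, for graphs on an arbitrary finite vertex type. -/
lemma exists_triangle_ramsey (s : ℕ) :
    ∃ (W : Type) (_ : Finite W) (H : SimpleGraph W), Arrows H (⊤ : SimpleGraph (Fin 3)) 2 ∧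
      ∃ c : Sym2 (W × Fin s) → Fin 2,
        ¬HasMonoCanonCopy H (⊤ : SimpleGraph (Fin 3)) s 2 2 c := by
  obtain ⟨M, hM⟩ := exists_mono_triple (TemplateIndex s → TemplateIndex s → Fin 2)
  obtain ⟨W, hW, H, q, hH, hc⟩ := exists_partite_ramsey (triangleUnion M s) trianglePart
    fun u v h => ne_of_apply_ne Prod.fst (trianglePart_fst_ne h)
  refine ⟨W, hW, H, arrows_triangle_of_forall fun c => ?_, blowupColouring q,
    not_hasMonoCanonCopy_blowupColouring hH⟩
  obtain ⟨φ, -, hφ, χ, hχ⟩ := hc c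
  obtain ⟨x, y, z, hxy, hyz, h₁, h₂⟩ := hM fun x y α β => χ (x, α) (y, β)
  obtain ⟨α, β, γ, hallowed, h₃, h₄⟩ := exists_mono_allowed_template fun α β => χ (x, α) (y, β)
  let τ : AllowedTriple M s := ⟨![(x, α), (y, β), (z, γ)], by
    refine Fin.strictMono_iff_lt_succ.2 fun n => ?_
    fin_cases n
    · exact hxy
    · exact hyz, hallowed⟩
  have hadj {m n : Fin 3} (h : m ≠ n) : (triangleUnion M s).Adj (τ, m) (τ, n) := ⟨rfl, h⟩
  have h01 := hadj (m := 0) (n := 1) (by decide)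
  have h12 := hadj (m := 1) (n := 2) (by decide)
  have h02 := hadj (m := 0) (n := 2) (by decide)
  refine ⟨_, _, _, hφ _ _ h01, hφ _ _ h12, hφ _ _ h02, ?_, ?_⟩
  · rw [hχ _ _ h01, hχ _ _ h12]
    exact h₃.trans (congrFun₂ h₁ β γ)
  · rw [hχ _ _ h01, hχ _ _ h02]
    exact h₄.trans (congrFun₂ h₂ α γ)

lemma Arrows.comap_equiv {α α' β : Type*} {G : SimpleGraph α} {H : SimpleGraph β} {r : ℕ}
    (h : Arrows G H r) (e : α' ≃ α) : Arrows (G.comap e) H r := by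
  intro c
  obtain ⟨f, hf, k, hk⟩ := h fun d => c (d.map e.symm)
  refine ⟨e.symm ∘ f, e.symm.injective.comp hf, k, fun u v huv => ⟨?_, (hk u v huv).2⟩⟩
  simpa using (hk u v huv).1

lemma HasMonoCanonCopy.of_comap_equiv {α α' β : Type*} {G : SimpleGraph α} {H : SimpleGraph β}
    {n t r : ℕ} (e : α' ≃ α) {c : Sym2 (α × Fin n) → Fin r}
    (h : HasMonoCanonCopy (G.comap e) H n t r fun d => c (d.map (Prod.map e id))) :
    HasMonoCanonCopy G H n t r c := by
  obtain ⟨f, hf, g, hg, k, hk⟩ := h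
  exact ⟨e ∘ f, e.injective.comp hf, g, hg, k, hk⟩

/-- For every integer `s ≥ 2` there is a graph `G` with `G →₂ K₃` but
`G[s] ↛₂ K₃[2]`: some `2`-colouring of the edges of the `s`-blowup of `G`
has no monochromatic canonical copy of the `2`-blowup of the triangle. -/
theorem triangle_blowup_dependence (s : ℕ) (hs : 2 ≤ s) :
    ∃ (N : ℕ) (G : SimpleGraph (Fin N)),
      Arrows G (⊤ : SimpleGraph (Fin 3)) 2 ∧
      ∃ c : Sym2 (Fin N × Fin s) → Fin 2,
        ¬ HasMonoCanonCopy G (⊤ : SimpleGraph (Fin 3)) s 2 2 c := by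
  obtain ⟨W, _, H, hH, c, hc⟩ := exists_triangle_ramsey s
  let e := (Finite.equivFin W).symm
  exact ⟨Nat.card W, H.comap e, hH.comap_equiv e, fun d => c (d.map (Prod.map e id)),
    fun h => hc (h.of_comap_equiv e)⟩
end

section
/- For every N ∈ ℕ there exists a finite simple graph G such that G →₂ K₃ and B(G →₂ K₃; 2) > N; that is, the blowup Ramsey numbers B(G →₂ K₃; 2) are unbounded over graphs G satisfying G →₂ K₃. -/
/-- The blowup Ramsey number `B(G →ᵣ H; t)`: the least `n` such that every
`r`-colouring of the edges of `G[n]` contains a monochromatic canonical copy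
of `H[t]`. -/
noncomputable def blowupRamsey {α β : Type*} (G : SimpleGraph α) (H : SimpleGraph β)
    (r t : ℕ) : ℕ :=
  sInf {n : ℕ | ∀ c : Sym2 (α × Fin n) → Fin r, HasMonoCanonCopy G H n t r c}

/-- No triangle of `G` is monochromatic under the edge colouring `c`. -/
def NoMonoTriangle {V : Type*} (G : SimpleGraph V) (c : Sym2 V → Fin 2) : Prop :=
  ∀ x y z, G.Adj x y → G.Adj y z → G.Adj x z → ¬(c s(x, y) = c s(x, z) ∧ c s(x, y) = c s(y, z))

/-- The colouring `F` of the blowup of `G` contains no monochromatic canonical `K₃[2]`. -/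
def NoMonoTriangleBlowup {V A : Type*} (G : SimpleGraph V) (F : V × A → V × A → Fin 2) : Prop :=
  ∀ x y z, G.Adj x y → G.Adj y z → G.Adj x z →
    ∀ f g h : Fin 2 → A, f.Injective → g.Injective → h.Injective → ∀ k,
      (∀ i j, F (x, f i) (y, g j) = k) → (∀ i j, F (y, g i) (z, h j) = k) →
      (∀ i j, F (x, f i) (z, h j) = k) → False

/-- `ab` and `a'b` are edges with `a`, `a'` non-adjacent, and the blowup colouring `F` is constant
on the union of their blowups. -/
structure IsTwinTriple {V A : Type*} (G : SimpleGraph V) (F : V × A → V × A → Fin 2)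
    (a a' b : V) (k : Fin 2) : Prop where
  left : G.Adj a b
  right : G.Adj a' b
  not_adj : ¬G.Adj a a'
  colour_left : ∀ i j, F (a, i) (b, j) = k
  colour_right : ∀ i j, F (a', i) (b, j) = k

section Finiteness

theorem exists_mono_bipartite (t : ℕ) : ∃ n, ∀ F : Fin n → Fin n → Fin 2,
    ∃ f g : Fin t → Fin n, f.Injective ∧ g.Injective ∧ ∃ k, ∀ i j, F (f i) (g j) = k := by
  have embed : ∀ {m : ℕ} (s : Finset (Fin m)), t ≤ s.card →
      ∃ f : Fin t → Fin m, f.Injective ∧ ∀ i, f i ∈ s := fun s hs =>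
    ⟨fun i => s.orderEmbOfFin rfl (Fin.castLE hs i),
      (s.orderEmbOfFin rfl).injective.comp (Fin.castLE_injective hs),
      fun i => s.orderEmbOfFin_mem rfl _⟩
  let m := 2 * t
  let n := m + Fintype.card (Fin m → Fin 2) * t
  refine ⟨n, fun F => ?_⟩
  have hm : m ≤ n := Nat.le_add_right _ _
  obtain ⟨p, hp⟩ := Fintype.exists_le_card_fiber_of_mul_le_card (n := t)
    (fun (j : Fin n) (i : Fin m) => F (Fin.castLE hm i) j)
    (by simp only [Fintype.card_fin]; exact Nat.le_add_left _ _)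
  obtain ⟨k, hk⟩ := Fintype.exists_le_card_fiber_of_mul_le_card (n := t) p (by simp [m])
  obtain ⟨g, hg, hgp⟩ := embed _ hp
  obtain ⟨f, hf, hfk⟩ := embed _ hk
  refine ⟨Fin.castLE hm ∘ f, g, (Fin.castLE_injective hm).comp hf, hg, k, fun i j => ?_⟩
  have h₁ := hgp j
  have h₂ := hfk i
  simp only [Finset.mem_filter, Finset.mem_univ, true_and] at h₁ h₂
  rw [← h₂, ← h₁]
  rfl

theorem exists_mono_on_pairs {V : Type*} [DecidableEq V] (S : Finset (V × V)) (t : ℕ) :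
    ∃ n, ∀ c : Sym2 (V × Fin n) → Fin 2, ∃ g : V → Fin t → Fin n, (∀ v, (g v).Injective) ∧
      ∀ p ∈ S, p.1 ≠ p.2 → ∃ k, ∀ i j, c s((p.1, g p.1 i), (p.2, g p.2 j)) = k := by
  induction S using Finset.induction_on with
  | empty => exact ⟨t, fun c => ⟨fun _ => id, fun _ => Function.injective_id, by simp⟩⟩
  | insert p S _ ih =>
    obtain ⟨n, hn⟩ := ih
    obtain ⟨m, hm⟩ := exists_mono_bipartite n
    refine ⟨m, fun c => ?_⟩
    obtain ⟨f, g, hf, hg, k, hk⟩ := hm fun i j => c s((p.1, i), (p.2, j))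
    let e : V → Fin n → Fin m := fun v => if v = p.1 then f else g
    have he : ∀ v, (e v).Injective := fun v => by
      by_cases hv : v = p.1 <;> simp [e, hv, hf, hg]
    obtain ⟨d, hd, hdS⟩ := hn fun q => c (q.map fun v => (v.1, e v.1 v.2))
    refine ⟨fun v => e v ∘ d v, fun v => (he v).comp (hd v), fun q hq hne => ?_⟩
    rcases Finset.mem_insert.1 hq with rfl | hq
    · exact ⟨k, fun i j => by simpa [e, hne.symm] using hk (d q.1 i) (d q.2 j)⟩
    · simpa using hdS q hq hne

theorem Arrows.exists_hasMonoCanonCopy {V β : Type*} [Finite V] {G : SimpleGraph V}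
    {H : SimpleGraph β} (h : Arrows G H 2) {t : ℕ} (ht : 0 < t) :
    ∃ n, ∀ c : Sym2 (V × Fin n) → Fin 2, HasMonoCanonCopy G H n t 2 c := by
  classical
  have := Fintype.ofFinite V
  obtain ⟨n, hn⟩ := exists_mono_on_pairs (Finset.univ : Finset (V × V)) t
  refine ⟨n, fun c => ?_⟩
  obtain ⟨g, hg, hgc⟩ := hn c
  obtain ⟨f, hf, k, hk⟩ := h fun e => c (e.map fun v => (v, g v ⟨0, ht⟩))
  refine ⟨f, hf, fun u => g (f u), fun u => hg _, k, fun u v huv => ⟨(hk u v huv).1, fun i j => ?_⟩⟩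
  obtain ⟨l, hl⟩ := hgc (f u, f v) (Finset.mem_univ _) (hf.ne huv.ne)
  rw [hl i j, ← (hk u v huv).2, Sym2.map_mk, ← hl ⟨0, ht⟩ ⟨0, ht⟩]

end Finiteness

section TwinExtension

set_option synthInstance.maxHeartbeats 400000 in
set_option synthInstance.maxSize 100000 in
set_option maxRecDepth 100000 in
/-- In a 2-colouring of `K₆` minus the edge `aa'` on `a, a', b, p, q, r` without monochromatic
triangles, `ab` and `a'b` have the same colour. -/
theorem twin_edges_eq : ∀ bp bq br pq pr qr : Fin 2,
    ¬(bp = bq ∧ bp = pq) → ¬(bp = br ∧ bp = pr) → ¬(bq = br ∧ bq = qr) → ¬(pq = pr ∧ pq = qr) →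
    ∀ ab ap aq ar : Fin 2,
    ¬(ab = ap ∧ ab = bp) → ¬(ab = aq ∧ ab = bq) → ¬(ab = ar ∧ ab = br) →
    ¬(ap = aq ∧ ap = pq) → ¬(ap = ar ∧ ap = pr) → ¬(aq = ar ∧ aq = qr) →
    ∀ ab' ap' aq' ar' : Fin 2,
    ¬(ab' = ap' ∧ ab' = bp) → ¬(ab' = aq' ∧ ab' = bq) → ¬(ab' = ar' ∧ ab' = br) →
    ¬(ap' = aq' ∧ ap' = pq) → ¬(ap' = ar' ∧ ap' = pr) → ¬(aq' = ar' ∧ aq' = qr) →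
    ab = ab' := by
  decide

variable {V I A : Type*}

/-- Attach to each triple `a t, a' t, b t` a new triangle completely joined to it. -/
def twinExtension (G : SimpleGraph V) (a a' b : I → V) : SimpleGraph (V ⊕ I × Fin 3) where
  Adj
    | .inl x, .inl y => G.Adj x y
    | .inl x, .inr (t, _) => x = a t ∨ x = a' t ∨ x = b t
    | .inr (t, _), .inl x => x = a t ∨ x = a' t ∨ x = b t
    | .inr (t, p), .inr (s, q) => t = s ∧ p ≠ q
  symm := ⟨by
    rintro (x | ⟨t, p⟩) (y | ⟨s, q⟩) h
    · exact G.adj_symm h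
    · exact h
    · exact h
    · exact ⟨h.1.symm, h.2.symm⟩⟩
  loopless := ⟨by
    rintro (x | ⟨t, p⟩) h
    · exact G.loopless.irrefl _ h
    · exact h.2 rfl⟩

theorem NoMonoTriangle.of_twinExtension {G : SimpleGraph V} {a a' b : I → V}
    {c : Sym2 (V ⊕ I × Fin 3) → Fin 2} (hc : NoMonoTriangle (twinExtension G a a' b) c) :
    NoMonoTriangle G (fun e => c (e.map .inl)) :=
  fun x y z hxy hyz hxz => hc (.inl x) (.inl y) (.inl z) hxy hyz hxz

theorem NoMonoTriangle.twinExtension_eq {G : SimpleGraph V} {a a' b : I → V}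
    {c : Sym2 (V ⊕ I × Fin 3) → Fin 2} (hc : NoMonoTriangle (twinExtension G a a' b) c) (t : I)
    (h : G.Adj (a t) (b t)) (h' : G.Adj (a' t) (b t)) :
    c s(.inl (a t), .inl (b t)) = c s(.inl (a' t), .inl (b t)) := by
  have ha : ∀ p, (twinExtension G a a' b).Adj (.inl (a t)) (.inr (t, p)) := fun _ => .inl rfl
  have ha' : ∀ p, (twinExtension G a a' b).Adj (.inl (a' t)) (.inr (t, p)) :=
    fun _ => .inr (.inl rfl)
  have hb : ∀ p, (twinExtension G a a' b).Adj (.inl (b t)) (.inr (t, p)) :=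
    fun _ => .inr (.inr rfl)
  have hp : ∀ p q, p ≠ q → (twinExtension G a a' b).Adj (.inr (t, p)) (.inr (t, q)) :=
    fun _ _ h => ⟨rfl, h⟩
  have hl : (twinExtension G a a' b).Adj (.inl (a t)) (.inl (b t)) := h
  have hr : (twinExtension G a a' b).Adj (.inl (a' t)) (.inl (b t)) := h'
  have h01 := hp 0 1 (by decide)
  have h02 := hp 0 2 (by decide)
  have h12 := hp 1 2 (by decide)
  exact twin_edges_eq _ _ _ _ _ _
    (hc _ _ _ (hb 0) h01 (hb 1)) (hc _ _ _ (hb 0) h02 (hb 2)) (hc _ _ _ (hb 1) h12 (hb 2))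
    (hc _ _ _ h01 h12 h02) _ _ _ _
    (hc _ _ _ hl (hb 0) (ha 0)) (hc _ _ _ hl (hb 1) (ha 1)) (hc _ _ _ hl (hb 2) (ha 2))
    (hc _ _ _ (ha 0) h01 (ha 1)) (hc _ _ _ (ha 0) h02 (ha 2)) (hc _ _ _ (ha 1) h12 (ha 2))
    _ _ _ _
    (hc _ _ _ hr (hb 0) (ha' 0)) (hc _ _ _ hr (hb 1) (ha' 1)) (hc _ _ _ hr (hb 2) (ha' 2))
    (hc _ _ _ (ha' 0) h01 (ha' 1)) (hc _ _ _ (ha' 0) h02 (ha' 2)) (hc _ _ _ (ha' 1) h12 (ha' 2))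

open Classical in
/-- The colour of the edge between an old vertex `x` and the `p`-th vertex of a new triangle. -/
noncomputable def twinJoinColour (b : I → V) (k : I → Fin 2) (x : V) (t : I) (p : Fin 3) : Fin 2 :=
  k t + if x = b t then ![1, 0, 1] p else ![0, 1, 1] p

open Classical in
/-- Extend a blowup colouring to the twin extension: `k t` is the colour of the pentagon formed by
`a t`, `b t` and the new vertices `1, 2, 0` in cyclic order. -/
noncomputable def twinColour (F : V × A → V × A → Fin 2) (b : I → V) (k : I → Fin 2) :
    (V ⊕ I × Fin 3) × A → (V ⊕ I × Fin 3) × A → Fin 2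
  | (.inl x, i), (.inl y, j) => F (x, i) (y, j)
  | (.inl x, _), (.inr (t, p), _) => twinJoinColour b k x t p
  | (.inr (t, p), _), (.inl x, _) => twinJoinColour b k x t p
  | (.inr (t, p), _), (.inr (s, q), _) => if t = s then k t + if p + q = 1 then 1 else 0 else 0

theorem twinColour_comm {F : V × A → V × A → Fin 2} (hF : ∀ p q, F p q = F q p) (b : I → V)
    (k : I → Fin 2) (p q) : twinColour F b k p q = twinColour F b k q p := by
  obtain ⟨x | ⟨t, p⟩, i⟩ := p <;> obtain ⟨y | ⟨s, q⟩, j⟩ := q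
  · exact hF _ _
  · rfl
  · rfl
  · by_cases h : t = s
    · subst h; simp [twinColour, add_comm]
    · simp [twinColour, h, Ne.symm h]

theorem NoMonoTriangleBlowup.twinColour {G : SimpleGraph V} {F : V × A → V × A → Fin 2}
    (hF : ∀ p q, F p q = F q p) (hG : NoMonoTriangleBlowup G F) {a a' b : I → V} {k : I → Fin 2}
    (ht : ∀ t, IsTwinTriple G F (a t) (a' t) (b t) (k t)) :
    NoMonoTriangleBlowup (twinExtension G a a' b) (twinColour F b k) := by
  have root_pair : ∀ t p x y i j l, G.Adj x y → (x = a t ∨ x = a' t ∨ x = b t) →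
      (y = a t ∨ y = a' t ∨ y = b t) → F (x, i) (y, j) = l → twinJoinColour b k x t p = l →
      twinJoinColour b k y t p = l → False := by
    intro t p x y i j l hxy hx hy h₁ h₂ h₃
    have key : ∀ (κ : Fin 2) (p : Fin 3), κ + ![0, 1, 1] p = κ → κ + ![1, 0, 1] p = κ → False := by
      decide
    have hl := (ht t).left
    have hr := (ht t).right
    rcases hx with rfl | rfl | rfl <;> rcases hy with rfl | rfl | rfl
    · exact G.loopless.irrefl _ hxy
    · exact (ht t).not_adj hxy
    · rw [(ht t).colour_left] at h₁; subst h₁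
      exact key (k t) p (by simpa [twinJoinColour, hl.ne] using h₂)
        (by simpa [twinJoinColour] using h₃)
    · exact (ht t).not_adj hxy.symm
    · exact G.loopless.irrefl _ hxy
    · rw [(ht t).colour_right] at h₁; subst h₁
      exact key (k t) p (by simpa [twinJoinColour, hr.ne] using h₂)
        (by simpa [twinJoinColour] using h₃)
    · rw [hF, (ht t).colour_left] at h₁; subst h₁
      exact key (k t) p (by simpa [twinJoinColour, hl.ne] using h₃)
        (by simpa [twinJoinColour] using h₂)
    · rw [hF, (ht t).colour_right] at h₁; subst h₁
      exact key (k t) p (by simpa [twinJoinColour, hr.ne] using h₃)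
        (by simpa [twinJoinColour] using h₂)
    · exact G.loopless.irrefl _ hxy
  have one_root : ∀ t p q x l, p ≠ q → twinJoinColour b k x t p = l →
      twinJoinColour b k x t q = l → (k t + if p + q = 1 then 1 else 0) = l → False := by
    intro t p q x l hpq h₁ h₂ h₃
    have key : ∀ (κ l : Fin 2) (p q : Fin 3), p ≠ q → (κ + if p + q = 1 then 1 else 0) = l →
        ¬(κ + ![0, 1, 1] p = l ∧ κ + ![0, 1, 1] q = l) ∧
        ¬(κ + ![1, 0, 1] p = l ∧ κ + ![1, 0, 1] q = l) := by decide
    have := key (k t) l p q hpq h₃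
    unfold twinJoinColour at h₁ h₂
    split_ifs at h₁ h₂
    · exact this.2 ⟨h₁, h₂⟩
    · exact this.1 ⟨h₁, h₂⟩
  rintro (x | ⟨t, p⟩) (y | ⟨s, q⟩) (z | ⟨u, r⟩) hxy hyz hxz f g h hf hg hh l h₁ h₂ h₃
  · exact hG x y z hxy hyz hxz f g h hf hg hh l h₁ h₂ h₃
  · exact root_pair u r x y _ _ l hxy hxz hyz (h₁ 0 0) (h₃ 0 0) (h₂ 0 0)
  · exact root_pair s q x z _ _ l hxz hxy hyz (h₃ 0 0) (h₁ 0 0) (h₂ 0 0)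
  · obtain ⟨rfl, hne⟩ := hyz
    exact one_root s q r x l hne (h₁ 0 0) (h₃ 0 0) (by simpa [_root_.twinColour] using h₂ 0 0)
  · exact root_pair t p y z _ _ l hyz hxy hxz (h₂ 0 0) (h₁ 0 0) (h₃ 0 0)
  · obtain ⟨rfl, hne⟩ := hxz
    exact one_root t p r y l hne (h₁ 0 0) (h₂ 0 0) (by simpa [_root_.twinColour] using h₃ 0 0)
  · obtain ⟨rfl, hne⟩ := hxy
    exact one_root t p q z l hne (h₃ 0 0) (h₂ 0 0) (by simpa [_root_.twinColour] using h₁ 0 0)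
  · obtain ⟨rfl, hpq⟩ := hxy
    obtain ⟨rfl, hqr⟩ := hyz
    have key : ∀ (κ l : Fin 2) (p q r : Fin 3), p ≠ q → q ≠ r → p ≠ r →
        (κ + if p + q = 1 then 1 else 0) = l → (κ + if q + r = 1 then 1 else 0) = l →
        (κ + if p + r = 1 then 1 else 0) = l → False := by decide
    exact key (k t) l p q r hpq hqr hxz.2 (by simpa [_root_.twinColour] using h₁ 0 0)
      (by simpa [_root_.twinColour] using h₂ 0 0) (by simpa [_root_.twinColour] using h₃ 0 0)

/-- If every triangle-free 2-colouring of `G` violates an equality between the edges of a twin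
triple, then some larger graph arrows the triangle and still has a good blowup colouring. -/
theorem exists_forcing_twin_triples {V A : Type} [Finite V] {G : SimpleGraph V}
    {F : V × A → V × A → Fin 2} (hF : ∀ p q, F p q = F q p) (hG : NoMonoTriangleBlowup G F)
    (hc : ∀ c, NoMonoTriangle G c →
      ∃ a a' b k, IsTwinTriple G F a a' b k ∧ c s(a, b) ≠ c s(a', b)) :
    ∃ (W : Type) (_ : Finite W) (G' : SimpleGraph W) (F' : W × A → W × A → Fin 2),
      (∀ p q, F' p q = F' q p) ∧ NoMonoTriangleBlowup G' F' ∧ ∀ c, ¬NoMonoTriangle G' c := by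
  let I := {t : V × V × V × Fin 2 // IsTwinTriple G F t.1 t.2.1 t.2.2.1 t.2.2.2}
  let a : I → V := fun t => t.1.1
  let a' : I → V := fun t => t.1.2.1
  let b : I → V := fun t => t.1.2.2.1
  let k : I → Fin 2 := fun t => t.1.2.2.2
  refine ⟨V ⊕ I × Fin 3, inferInstance, twinExtension G a a' b, twinColour F b k,
    twinColour_comm hF b k, hG.twinColour hF fun t => t.2, fun c h => ?_⟩
  obtain ⟨x, x', y, l, ht, hne⟩ := hc _ h.of_twinExtension
  exact hne (h.twinExtension_eq (⟨(x, x', y, l), ht⟩ : I) ht.left ht.right)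

end TwinExtension

section Fan

/-- Adjacency among the hubs: a `K₅` on `0, …, 4` and a pendant edge `05`. -/
def hubAdj (g h : Fin 7) : Prop :=
  (g ≠ h ∧ g < 5 ∧ h < 5) ∨ (g = 0 ∧ h = 5) ∨ (g = 5 ∧ h = 0)

instance : DecidableRel hubAdj := fun _ _ => inferInstanceAs (Decidable (_ ∨ _))

/-- Adjacency between a hub and the `i`-th vertex of the path: hub `6` is the apex of the fan, and
hubs `5` and `3` see the even and the odd vertices respectively. -/
def hubPathAdj (h : Fin 7) (i : ℕ) : Prop :=
  h = 6 ∨ (h = 5 ∧ i % 2 = 0) ∨ (h = 3 ∧ i % 2 = 1)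

/-- A fan over a path with `m` vertices, together with the hubs that control the colours of the
path. -/
def fanGraph (m : ℕ) : SimpleGraph (Fin 7 ⊕ Fin m) where
  Adj
    | .inl g, .inl h => hubAdj g h
    | .inl h, .inr i => hubPathAdj h i
    | .inr i, .inl h => hubPathAdj h i
    | .inr i, .inr j => i.1 + 1 = j.1 ∨ j.1 + 1 = i.1
  symm := ⟨by
    rintro (g | i) (h | j) H
    · revert g h; change ∀ g h, hubAdj g h → hubAdj h g; decide
    · exact H
    · exact H
    · exact H.symm⟩
  loopless := ⟨by
    rintro (g | i) H
    · revert g; change ∀ g, hubAdj g g → False; decide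
    · change i.1 + 1 = i.1 ∨ i.1 + 1 = i.1 at H; omega⟩

/-- The parity of `i` as a colour. -/
def parityColour (i : ℕ) : Fin 2 := ⟨i % 2, Nat.mod_lt _ two_pos⟩

/-- The colour of an edge between hubs; colour `0` is a pentagon in the `K₅`, plus the pendant
edge. -/
def hubColour (g h : Fin 7) : Fin 2 :=
  if (g, h) ∈ [((0 : Fin 7), (1 : Fin 7)), (0, 2), (1, 3), (3, 4), (2, 4), (0, 5)] ∨
    (h, g) ∈ [((0 : Fin 7), (1 : Fin 7)), (0, 2), (1, 3), (3, 4), (2, 4), (0, 5)] then 0 else 1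

/-- The colour of an edge between the copy `a` of a hub and the `i`-th vertex of the path. The copy
`a` of the apex follows the parity up to `i = a` and its opposite afterwards. -/
def hubPathColour (h : Fin 7) (a i : ℕ) : Fin 2 :=
  if h = 6 then (if i ≤ a then parityColour i else parityColour (i + 1))
  else if h = 5 then 0 else 1

/-- The blowup colouring of the fan. -/
def fanColour {m n : ℕ} : (Fin 7 ⊕ Fin m) × Fin n → (Fin 7 ⊕ Fin m) × Fin n → Fin 2
  | (.inl g, _), (.inl h, _) => hubColour g h
  | (.inl h, a), (.inr i, _) => hubPathColour h a i
  | (.inr i, _), (.inl h, a) => hubPathColour h a i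
  | (.inr i, _), (.inr j, _) => parityColour (min i j)

theorem fanColour_comm {m n : ℕ} (p q : (Fin 7 ⊕ Fin m) × Fin n) :
    fanColour p q = fanColour q p := by
  obtain ⟨g | i, a⟩ := p <;> obtain ⟨h | j, a'⟩ := q
  · change hubColour g h = hubColour h g
    simp only [hubColour, or_comm]
  · rfl
  · rfl
  · simp only [fanColour, min_comm]

theorem noMonoTriangleBlowup_fanColour (m n : ℕ) :
    NoMonoTriangleBlowup (fanGraph m) (fanColour (n := n)) := by
  have hub_pair : ∀ g h i, hubAdj g h → hubPathAdj g i → hubPathAdj h i → False := by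
    intro g h i hgh hg hh
    rcases hg with rfl | ⟨rfl, _⟩ | ⟨rfl, _⟩ <;> rcases hh with rfl | ⟨rfl, _⟩ | ⟨rfl, _⟩ <;>
      revert hgh <;> decide
  have path_pair : ∀ (h : Fin 7) (i j : ℕ) (f : Fin 2 → Fin n) l, f.Injective →
      (i + 1 = j ∨ j + 1 = i) → hubPathAdj h i → hubPathAdj h j → parityColour (min i j) = l →
      (∀ e, hubPathColour h (f e) i = l) → (∀ e, hubPathColour h (f e) j = l) → False := by
    intro h i j f l hf hij hi hj h₁ h₂ h₃
    have h6 : h = 6 := by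
      rcases hi with rfl | ⟨rfl, _⟩ | ⟨rfl, _⟩ <;> rcases hj with hj | ⟨hj, _⟩ | ⟨hj, _⟩ <;>
        first | rfl | omega
    subst h6
    have val : ∀ e, (f e : ℕ) = min i j := fun e => by
      have hi' := h₂ e
      have hj' := h₃ e
      subst h₁
      simp only [hubPathColour, if_true, parityColour] at hi' hj'
      split_ifs at hi' hj' <;> simp only [Fin.mk.injEq] at hi' hj' <;> omega
    exact absurd (hf (Fin.ext ((val 0).trans (val 1).symm))) (by decide)
  rintro (x | x) (y | y) (z | z) hxy hyz hxz f g h hf hg hh l h₁ h₂ h₃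
  · have key : ∀ x y z, hubAdj x y → hubAdj y z → hubAdj x z →
        ¬(hubColour x y = hubColour y z ∧ hubColour x y = hubColour x z) := by decide
    exact key x y z hxy hyz hxz ⟨(h₁ 0 0).trans (h₂ 0 0).symm, (h₁ 0 0).trans (h₃ 0 0).symm⟩
  · exact hub_pair x y z hxy hxz hyz
  · exact hub_pair x z y hxz hxy hyz
  · exact path_pair x y z f l hf hyz hxy hxz (h₂ 0 0) (fun e => h₁ e 0) (fun e => h₃ e 0)
  · exact hub_pair y z x hyz hxy hxz
  · exact path_pair y x z g l hg hxz hxy hyz (h₃ 0 0) (fun e => h₁ 0 e) (fun e => h₂ e 0)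
  · exact path_pair z x y h l hh hxy hxz hyz (h₁ 0 0) (fun e => h₃ 0 e) (fun e => h₂ 0 e)
  · change x.1 + 1 = y.1 ∨ y.1 + 1 = x.1 at hxy
    change y.1 + 1 = z.1 ∨ z.1 + 1 = y.1 at hyz
    change x.1 + 1 = z.1 ∨ z.1 + 1 = x.1 at hxz
    omega

theorem exists_twinTriple_ne_of_noMonoTriangle_fan (n : ℕ)
    (c : Sym2 (Fin 7 ⊕ Fin (2 * n + 4)) → Fin 2) (hc : NoMonoTriangle (fanGraph (2 * n + 4)) c) :
    ∃ a a' b k, IsTwinTriple (fanGraph (2 * n + 4)) (fanColour (n := n)) a a' b k ∧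
      c s(a, b) ≠ c s(a', b) := by
  by_contra! H
  let v : ∀ i, i < 2 * n + 4 → Fin 7 ⊕ Fin (2 * n + 4) := fun i hi => .inr ⟨i, hi⟩
  let o : Fin 7 → Fin 7 ⊕ Fin (2 * n + 4) := .inl
  have hub : ∀ g h, hubAdj g h → (fanGraph (2 * n + 4)).Adj (o g) (o h) := fun _ _ h => h
  -- the hub edges `01`, `02` agree with `05`, so `03` has the other colour
  have h51 : c s(o 5, o 0) = c s(o 1, o 0) := H _ _ _ 0
    ⟨hub _ _ (by decide), hub _ _ (by decide), (by decide : ¬hubAdj 5 1),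
      fun _ _ => by change hubColour 5 0 = 0; decide,
      fun _ _ => by change hubColour 1 0 = 0; decide⟩
  have h52 : c s(o 5, o 0) = c s(o 2, o 0) := H _ _ _ 0
    ⟨hub _ _ (by decide), hub _ _ (by decide), (by decide : ¬hubAdj 5 2),
      fun _ _ => by change hubColour 5 0 = 0; decide,
      fun _ _ => by change hubColour 2 0 = 0; decide⟩
  have h53 : c s(o 5, o 0) ≠ c s(o 3, o 0) := by
    have t12 := hc (o 0) (o 1) (o 2) (hub _ _ (by decide)) (hub _ _ (by decide))
      (hub _ _ (by decide))
    have t13 := hc (o 0) (o 1) (o 3) (hub _ _ (by decide)) (hub _ _ (by decide))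
      (hub _ _ (by decide))
    have t23 := hc (o 0) (o 2) (o 3) (hub _ _ (by decide)) (hub _ _ (by decide))
      (hub _ _ (by decide))
    have t := hc (o 1) (o 2) (o 3) (hub _ _ (by decide)) (hub _ _ (by decide))
      (hub _ _ (by decide))
    rw [Sym2.eq_swap (a := o 1)] at h51
    rw [Sym2.eq_swap (a := o 2)] at h52
    rw [Sym2.eq_swap (a := o 3)]
    omega
  have even_edge : ∀ i (hi : i < 2 * n + 4), i % 2 = 0 → c s(o 5, v i hi) = c s(o 5, o 0) := by
    intro i hi h2
    rw [Sym2.eq_swap, Sym2.eq_swap (b := o 0)]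
    exact H _ _ _ 0 ⟨.inr (.inl ⟨rfl, h2⟩), hub _ _ (by decide),
      fun h => by rcases (h : hubPathAdj 0 i) with h | ⟨h, _⟩ | ⟨h, _⟩ <;> revert h <;> decide,
      fun _ _ => rfl, fun _ _ => by change hubColour 0 5 = 0; decide⟩
  have odd_edge : ∀ i (hi : i < 2 * n + 4), i % 2 = 1 → c s(o 3, v i hi) = c s(o 3, o 0) := by
    intro i hi h2
    rw [Sym2.eq_swap, Sym2.eq_swap (b := o 0)]
    exact H _ _ _ 1 ⟨.inr (.inr ⟨rfl, h2⟩), hub _ _ (by decide),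
      fun h => by rcases (h : hubPathAdj 0 i) with h | ⟨h, _⟩ | ⟨h, _⟩ <;> revert h <;> decide,
      fun _ _ => rfl, fun _ _ => by change hubColour 0 3 = 1; decide⟩
  have even_path : ∀ i (hi : i + 1 < 2 * n + 4), i % 2 = 0 →
      c s(v i (by omega), v (i + 1) hi) = c s(o 5, o 0) := by
    intro i hi h2
    rw [← even_edge i (by omega) h2, Sym2.eq_swap]
    refine H _ _ _ 0 ⟨.inr rfl, .inr (.inl ⟨rfl, h2⟩), fun h => ?_, fun _ _ => ?_, fun _ _ => rfl⟩
    · rcases (h : hubPathAdj 5 (i + 1)) with h | ⟨_, h⟩ | ⟨h, _⟩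
      · revert h; decide
      · change (i + 1) % 2 = 0 at h; omega
      · revert h; decide
    · change parityColour (min (i + 1) i) = 0
      simp [parityColour, h2]
  have odd_path : ∀ i (hi : i + 1 < 2 * n + 4), i % 2 = 1 →
      c s(v i (by omega), v (i + 1) hi) = c s(o 3, o 0) := by
    intro i hi h2
    rw [← odd_edge i (by omega) h2, Sym2.eq_swap]
    refine H _ _ _ 1 ⟨.inr rfl, .inr (.inr ⟨rfl, h2⟩), fun h => ?_, fun _ _ => ?_, fun _ _ => rfl⟩
    · rcases (h : hubPathAdj 3 (i + 1)) with h | ⟨h, _⟩ | ⟨_, h⟩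
      · revert h; decide
      · revert h; decide
      · change (i + 1) % 2 = 1 at h; omega
    · change parityColour (min (i + 1) i) = 1
      simp [parityColour, h2]
  have first : c s(o 6, v 0 (by omega)) = c s(o 5, o 0) := by
    rw [← even_edge 0 (by omega) rfl]
    exact H _ _ _ 0 ⟨.inl rfl, .inr (.inl ⟨rfl, rfl⟩),
      (by decide : ¬hubAdj 6 5), fun _ _ => rfl, fun _ _ => rfl⟩
  have last : c s(o 6, v (2 * n + 3) (by omega)) = c s(o 5, o 0) := by
    rw [← first, Sym2.eq_swap, Sym2.eq_swap (a := o 6)]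
    refine H _ _ _ 0 ⟨.inl rfl, .inl rfl, fun h => ?_, fun _ a => ?_, fun _ _ => rfl⟩
    · change 2 * n + 3 + 1 = 0 ∨ 0 + 1 = 2 * n + 3 at h
      omega
    · change hubPathColour 6 a (2 * n + 3) = 0
      have := a.2
      simp only [hubPathColour, parityColour, if_true]
      rw [if_neg (by omega)]
      exact Fin.ext (by simp only [Fin.val_zero]; omega)
  have apex : ∀ i (hi : i < 2 * n + 4), (i % 2 = 0 → c s(o 6, v i hi) = c s(o 5, o 0)) ∧
      (i % 2 = 1 → c s(o 6, v i hi) ≠ c s(o 5, o 0)) := by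
    intro i
    induction i with
    | zero => exact fun hi => ⟨fun _ => first, by simp⟩
    | succ i ih =>
      intro hi
      have ih := ih (by omega)
      have t := hc (o 6) (v i (by omega)) (v (i + 1) hi) (.inl rfl) (.inl rfl) (.inl rfl)
      have he := even_path i hi
      have ho := odd_path i hi
      omega
  exact (apex (2 * n + 3) (by omega)).2 (by omega) last

end Fan

theorem arrows_triangle_of_forall_not_noMonoTriangle {V : Type*} {G : SimpleGraph V}
    (h : ∀ c, ¬NoMonoTriangle G c) : Arrows G (⊤ : SimpleGraph (Fin 3)) 2 := by
  intro c
  have := h c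
  simp only [NoMonoTriangle, not_forall, not_not] at this
  obtain ⟨x, y, z, hxy, hyz, hxz, h₁, h₂⟩ := this
  have hinj : Function.Injective ![x, y, z] := by
    intro i j
    fin_cases i <;> fin_cases j <;>
      simp [hxy.ne, hyz.ne, hxz.ne, hxy.ne.symm, hyz.ne.symm, hxz.ne.symm]
  refine ⟨![x, y, z], hinj, c s(x, y), fun i j hij => ?_⟩
  fin_cases i <;> fin_cases j <;>
    simp_all [SimpleGraph.adj_comm, Sym2.eq_swap]

theorem not_hasMonoCanonCopy_of_noMonoTriangleBlowup {V : Type*} {n : ℕ} {G : SimpleGraph V}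
    {F : V × Fin n → V × Fin n → Fin 2} (hF : ∀ p q, F p q = F q p)
    (h : NoMonoTriangleBlowup G F) :
    ¬HasMonoCanonCopy G (⊤ : SimpleGraph (Fin 3)) n 2 2 (Sym2.lift ⟨F, hF⟩) := by
  rintro ⟨f, -, g, hg, k, hk⟩
  have h01 := hk 0 1 (by simp)
  have h12 := hk 1 2 (by simp)
  have h02 := hk 0 2 (by simp)
  exact h _ _ _ h01.1 h12.1 h02.1 _ _ _ (hg 0) (hg 1) (hg 2) k h01.2 h12.2 h02.2

theorem NoMonoTriangleBlowup.comap {V W A B : Type*} {G : SimpleGraph V}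
    {F : V × A → V × A → Fin 2} (h : NoMonoTriangleBlowup G F) (e : W → V) {ι : B → A}
    (hι : ι.Injective) :
    NoMonoTriangleBlowup (G.comap e) fun p q => F (e p.1, ι p.2) (e q.1, ι q.2) :=
  fun x y z hxy hyz hxz f g k hf hg hk l h₁ h₂ h₃ =>
    h (e x) (e y) (e z) hxy hyz hxz (ι ∘ f) (ι ∘ g) (ι ∘ k) (hι.comp hf) (hι.comp hg) (hι.comp hk)
      l h₁ h₂ h₃

theorem NoMonoTriangle.of_comap {V W : Type*} {G : SimpleGraph V} (e : V ≃ W) {c : Sym2 W → Fin 2}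
    (h : NoMonoTriangle (G.comap e.symm) c) : NoMonoTriangle G fun q => c (q.map e) :=
  fun x y z hxy hyz hxz => h (e x) (e y) (e z) (by simpa using hxy) (by simpa using hyz)
    (by simpa using hxz)

/-- The blowup Ramsey numbers `B(G →₂ K₃; 2)` are unbounded over graphs `G`
with `G →₂ K₃`: for every `N` there is a graph `G` with `G →₂ K₃` and
`B(G →₂ K₃; 2) > N`. -/
theorem blowupRamsey_triangle_unbounded (N : ℕ) :
    ∃ (M : ℕ) (G : SimpleGraph (Fin M)),
      Arrows G (⊤ : SimpleGraph (Fin 3)) 2 ∧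
      N < blowupRamsey G (⊤ : SimpleGraph (Fin 3)) 2 2 := by
  obtain ⟨W, _, G, F, hF, hG, hc⟩ := exists_forcing_twin_triples fanColour_comm
    (noMonoTriangleBlowup_fanColour (2 * N + 4) N) (exists_twinTriple_ne_of_noMonoTriangle_fan N)
  obtain ⟨M, ⟨e⟩⟩ := Finite.exists_equiv_fin W
  have harrows : Arrows (G.comap e.symm) (⊤ : SimpleGraph (Fin 3)) 2 :=
    arrows_triangle_of_forall_not_noMonoTriangle fun _ h => hc _ (h.of_comap e)
  refine ⟨M, G.comap e.symm, harrows, ?_⟩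
  by_contra! hle
  exact not_hasMonoCanonCopy_of_noMonoTriangleBlowup (fun _ _ => hF _ _)
    (hG.comap e.symm (Fin.castLE_injective hle))
    (Nat.sInf_mem (harrows.exists_hasMonoCanonCopy two_pos) _)
end

section
/- Let H be a 3-chromatically connected graph and let r ≥ 2 be an integer. Then for every integer s ≥ 2, there exists a finite simple graph G such that G →ᵣ H, but there exists an r-colouring of the edges of the s-blowup G[s] containing no monochromatic canonical copy of H[2]. -/
/-- A graph `H` is `3`-chromatically connected if it has at least `3` vertices
and for every vertex subset `s` inducing a bipartite (i.e. `2`-colourable)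
subgraph, the graph obtained by deleting `s` is connected. -/
def ThreeChromaticallyConnected {β : Type*} [Fintype β] (H : SimpleGraph β) : Prop :=
  3 ≤ Fintype.card β ∧
    ∀ s : Set β, (H.induce s).Colorable 2 → (H.induce sᶜ).Connected

namespace BlowupRamsey

section Copies

variable {α V Z β : Type} {r : ℕ}

/-- `f` embeds `H` into `G` so that all its edges receive the colour `k`. -/
structure IsMono (H : SimpleGraph β) (G : SimpleGraph α) (c : Sym2 α → Fin r) (f : β → α)
    (k : Fin r) : Prop where
  inj : Function.Injective f
  adj : ∀ {u v}, H.Adj u v → G.Adj (f u) (f v)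
  col : ∀ {u v}, H.Adj u v → c s(f u, f v) = k

/-- The colouring `c` of `G` has no monochromatic copy of `H`. -/
def MonoFree (H : SimpleGraph β) (G : SimpleGraph α) (c : Sym2 α → Fin r) : Prop :=
  ∀ f k, ¬ IsMono H G c f k

theorem arrows_iff (G : SimpleGraph α) (H : SimpleGraph β) :
    Arrows G H r ↔ ∀ c : Sym2 α → Fin r, ¬ MonoFree H G c := by
  refine forall_congr' fun c => ?_
  simp only [MonoFree, not_forall, not_not]
  refine exists_congr fun f => ⟨?_, ?_⟩
  · rintro ⟨hf, k, hk⟩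
    exact ⟨k, hf, fun h => (hk _ _ h).1, fun h => (hk _ _ h).2⟩
  · rintro ⟨k, h⟩
    exact ⟨h.inj, k, fun u v huv => ⟨h.adj huv, h.col huv⟩⟩

theorem MonoFree.pullback {H : SimpleGraph β} {G : SimpleGraph α} {A : SimpleGraph V}
    {c : Sym2 α → Fin r} (h : MonoFree H G c) (θ : V → α) (hθ : Function.Injective θ)
    (hadj : ∀ a b, A.Adj a b → G.Adj (θ a) (θ b)) : MonoFree H A (c ∘ Sym2.map θ) :=
  fun f k hf => h (θ ∘ f) k
    ⟨hθ.comp hf.inj, fun huv => hadj _ _ (hf.adj huv), fun huv => by simpa using hf.col huv⟩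

theorem induce_colorable_two {H : SimpleGraph β} {s : Set β} (κ : β → Bool)
    (hκ : ∀ u ∈ s, ∀ v ∈ s, H.Adj u v → κ u ≠ κ v) : (H.induce s).Colorable 2 := by
  have C : (H.induce s).Coloring Bool :=
    SimpleGraph.Coloring.mk (fun v => κ v) fun {u v} h => hκ u u.2 v v.2 h
  simpa using C.colorable

section Connectivity

variable [Fintype β] {H : SimpleGraph β}

theorem not_two_colorable (hH : ThreeChromaticallyConnected H) (κ : β → Bool)
    (hκ : ∀ u v, H.Adj u v → κ u ≠ κ v) : False := by
  obtain ⟨⟨v, hv⟩⟩ := (hH.2 Set.univ (induce_colorable_two κ fun u _ v _ => hκ u v)).nonempty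
  simp at hv

/-- A homomorphic image of a 3-chromatically connected graph cannot be split by a bipartite
set `B` separating `I` from the rest. -/
theorem hom_localized (hH : ThreeChromaticallyConnected H) {G : SimpleGraph Z} {f : β → Z}
    (hf : ∀ {u v}, H.Adj u v → G.Adj (f u) (f v)) (I B : Set Z) (κ : Z → Bool)
    (hκ : ∀ a ∈ B, ∀ b ∈ B, G.Adj a b → κ a ≠ κ b)
    (hIB : ∀ a ∈ I, ∀ b, b ∉ I → b ∉ B → ¬ G.Adj a b) :
    (∀ v, f v ∈ I → f v ∈ B) ∨ ∀ v, f v ∈ I ∨ f v ∈ B := by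
  by_contra! ⟨⟨v, hvI, hvB⟩, w, hwI, hwB⟩
  have hconn := hH.2 {v | f v ∈ B}
    (induce_colorable_two (κ ∘ f) fun u hu v hv huv => hκ _ hu _ hv (hf huv))
  obtain ⟨p⟩ := hconn.preconnected ⟨v, hvB⟩ ⟨w, hwB⟩
  have key : ∀ a b : ↥({v | f v ∈ B}ᶜ : Set β), (H.induce _).Walk a b → f a ∈ I → f b ∈ I := by
    intro a b p
    induction p with
    | nil => exact id
    | @cons a b _ h _ ih =>
      intro ha
      refine ih ?_
      by_contra hb
      exact hIB _ ha _ hb b.2 (hf h)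
  exact hwI (key _ _ p hvI)

/-- Every edge of a 3-chromatically connected graph can be continued at either end. -/
theorem exists_other_neighbor (hH : ThreeChromaticallyConnected H) {p q : β} (hpq : H.Adj p q) :
    ∃ q', q' ≠ q ∧ H.Adj p q' := by
  by_contra! hno
  obtain ⟨w, hw⟩ : ∃ w, w ∉ ({p, q} : Set β) := by
    by_contra! hall
    classical
    have : Fintype.card β ≤ ({p, q} : Finset β).card :=
      Finset.card_le_card fun w _ => by simpa using hall w
    have := Finset.card_le_two (a := p) (b := q)
    have := hH.1
    omega
  simp only [Set.mem_insert_iff, Set.mem_singleton_iff, not_or] at hw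
  have := hom_localized hH (f := id) (G := H) id {p} {q} (fun _ => true)
    (by simp) (by
      rintro a rfl b hbp hbq hab
      exact hno b (by simpa using hbq) hab)
  rcases this with h | h
  · exact hpq.ne (h p rfl)
  · exact (h w).elim hw.1 hw.2

theorem exists_adj (hH : ThreeChromaticallyConnected H) : ∃ p q, H.Adj p q := by
  by_contra! h
  exact not_two_colorable hH (fun _ => true) fun u v huv => (h u v huv).elim

end Connectivity

end Copies

section Extensions

variable {α V Z β : Type} {r : ℕ}

/-- A finite graph containing `S` as an induced subgraph, on the vertices of `S` together with
a set of further inner vertices. -/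
structure Extension {σ : Type} (S : SimpleGraph σ) where
  Inner : Type
  finite : Finite Inner
  graph : SimpleGraph (σ ⊕ Inner)
  adj_inl : ∀ {a b}, graph.Adj (.inl a) (.inl b) ↔ S.Adj a b

attribute [instance] Extension.finite

/-- The colouring `γ` of the frame extends to the whole graph without a monochromatic `H`. -/
def Extension.Realizes {σ : Type} {S : SimpleGraph σ} (E : Extension S) (H : SimpleGraph β)
    (γ : Sym2 σ → Fin r) : Prop :=
  ∃ c, MonoFree H E.graph c ∧ ∀ {a b}, S.Adj a b → c s(.inl a, .inl b) = γ s(a, b)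

section ofEmbedding

variable {σ : Type} {S : SimpleGraph σ} {A : SimpleGraph V}

/-- A finite graph seen as an extension of an induced subgraph. -/
abbrev Extension.ofEmbedding [Finite V] (A : SimpleGraph V) (j : S ↪g A) : Extension S where
  Inner := {v // v ∉ Set.range j}
  finite := inferInstance
  graph := A.comap (Sum.elim j Subtype.val)
  adj_inl := j.map_rel_iff

/-- The vertices of `ofEmbedding` are those of the original graph. -/
noncomputable def Extension.ofEmbeddingEquiv (j : S ↪g A) :
    σ ⊕ {v // v ∉ Set.range j} ≃ V :=
  Equiv.ofBijective (Sum.elim j Subtype.val) <| by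
    constructor
    · rintro (a | ⟨a, ha⟩) (b | ⟨b, hb⟩) h
      · simpa using h
      · exact (hb ⟨a, h⟩).elim
      · exact (ha ⟨b, h.symm⟩).elim
      · simpa using h
    · intro v
      by_cases hv : v ∈ Set.range j
      · obtain ⟨a, rfl⟩ := hv
        exact ⟨.inl a, rfl⟩
      · exact ⟨.inr ⟨v, hv⟩, rfl⟩

theorem Extension.ofEmbedding_realizes [Finite V] (j : S ↪g A) {H : SimpleGraph β}
    {γ : Sym2 σ → Fin r} : (Extension.ofEmbedding A j).Realizes H γ ↔
      ∃ c, MonoFree H A c ∧ ∀ {a b}, S.Adj a b → c s(j a, j b) = γ s(a, b) := by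
  let e := Extension.ofEmbeddingEquiv j
  have he : ∀ x, Sum.elim j Subtype.val x = e x := fun _ => rfl
  constructor
  · rintro ⟨c, hc, h⟩
    refine ⟨c ∘ Sym2.map e.symm, hc.pullback _ e.symm.injective fun a b hab => ?_,
      fun {a b} hab => ?_⟩
    · change A.Adj _ _
      rw [he, he]
      simpa using hab
    · have : ∀ a, e.symm (j a) = .inl a := fun a => e.symm_apply_eq.2 rfl
      rw [Function.comp_apply, Sym2.map_mk, this, this, h hab]
  · rintro ⟨c, hc, h⟩
    exact ⟨c ∘ Sym2.map e, hc.pullback _ e.injective fun a b hab => hab, fun {a b} hab => h hab⟩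

end ofEmbedding

section Glue

variable {ι Y : Type} {σ : ι → Type} {S : ∀ i, SimpleGraph (σ i)} {C : SimpleGraph Y}
  {φ : ∀ i, S i ↪g C} {E : ∀ i, Extension (S i)}

/-- The inclusion of the `i`-th piece in the glued graph. -/
def glueMap (φ : ∀ i, S i ↪g C) (E : ∀ i, Extension (S i)) (i : ι) :
    σ i ⊕ (E i).Inner → Y ⊕ (Σ i, (E i).Inner) :=
  Sum.map (φ i) fun t => ⟨i, t⟩

@[simp] theorem glueMap_inl (i : ι) (a : σ i) : glueMap φ E i (.inl a) = .inl (φ i a) := rfl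

@[simp] theorem glueMap_inr (i : ι) (t : (E i).Inner) : glueMap φ E i (.inr t) = .inr ⟨i, t⟩ := rfl

theorem glueMap_injective (i : ι) : Function.Injective (glueMap φ E i) :=
  Sum.map_injective.2 ⟨(φ i).injective, fun a b h => by simpa using h⟩

/-- Glue the extensions `E i` to the core `C` along embeddings of their frames. -/
abbrev glue [Finite ι] (φ : ∀ i, S i ↪g C) (E : ∀ i, Extension (S i)) : Extension C where
  Inner := Σ i, (E i).Inner
  finite := inferInstance
  graph :=
    { Adj := fun a b => (∃ p q, C.Adj p q ∧ a = .inl p ∧ b = .inl q) ∨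
        ∃ i v w, (E i).graph.Adj v w ∧ a = glueMap φ E i v ∧ b = glueMap φ E i w
      symm := ⟨by
        rintro a b (⟨p, q, h, rfl, rfl⟩ | ⟨i, v, w, h, rfl, rfl⟩)
        · exact .inl ⟨q, p, h.symm, rfl, rfl⟩
        · exact .inr ⟨i, w, v, h.symm, rfl, rfl⟩⟩
      loopless := ⟨by
        rintro a (⟨p, q, h, rfl, hq⟩ | ⟨i, v, w, h, rfl, hw⟩)
        · exact h.ne (Sum.inl_injective hq)
        · exact h.ne (glueMap_injective i hw)⟩ }
  adj_inl := by
    refine fun {a b} => ⟨?_, fun h => .inl ⟨a, b, h, rfl, rfl⟩⟩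
    rintro (⟨p, q, h, hp, hq⟩ | ⟨i, v | v, w | w, h, hv, hw⟩)
    · cases hp; cases hq; exact h
    · cases hv; cases hw; exact (φ i).map_rel_iff.2 ((E i).adj_inl.1 h)
    · cases hw
    · cases hv
    · cases hv

variable [Finite ι]

theorem glue_adj_glueMap {i : ι} {v w : σ i ⊕ (E i).Inner} :
    (glue φ E).graph.Adj (glueMap φ E i v) (glueMap φ E i w) ↔ (E i).graph.Adj v w := by
  refine ⟨?_, fun h => .inr ⟨i, v, w, h, rfl, rfl⟩⟩
  rcases v with v | v <;> rcases w with w | w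
  · intro h
    exact (E i).adj_inl.2 ((φ i).map_rel_iff.1 ((glue φ E).adj_inl.1 h))
  all_goals
    rintro (⟨p, q, h, hp, hq⟩ | ⟨j, v', w', h, hv, hw⟩)
    · simp at hp hq
    · obtain rfl : i = j := by
        rcases v' with v' | v' <;> rcases w' with w' | w' <;> simp_all [Sigma.mk.injEq]
      rwa [glueMap_injective i hv, glueMap_injective i hw]

theorem glue_adj_inr {i : ι} {t : (E i).Inner} {b : Y ⊕ (Σ i, (E i).Inner)}
    (h : (glue φ E).graph.Adj (.inr ⟨i, t⟩) b) : b ∈ Set.range (glueMap φ E i) := by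
  rcases h with ⟨p, q, _, hp, _⟩ | ⟨j, v, w, _, hv, rfl⟩
  · cases hp
  · rcases v with v | v
    · cases hv
    · simp only [glueMap_inr, Sum.inr.injEq, Sigma.mk.injEq] at hv
      obtain ⟨rfl, _⟩ := hv
      exact ⟨w, rfl⟩

/-- A copy of `H` in a graph glued along bipartite frames lies in the core or in one piece. -/
theorem glue_hom_localized [Fintype β] {H : SimpleGraph β} (hH : ThreeChromaticallyConnected H)
    (κ : ∀ i, (S i).Coloring Bool) {f : β → Y ⊕ (Σ i, (E i).Inner)}
    (hf : ∀ {u v}, H.Adj u v → (glue φ E).graph.Adj (f u) (f v)) :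
    (∀ v, ∃ y, f v = .inl y) ∨ ∃ i, ∀ v, ∃ t, f v = glueMap φ E i t := by
  by_cases hcore : ∀ v, ∃ y, f v = .inl y
  · exact .inl hcore
  push Not at hcore
  obtain ⟨v, hv⟩ := hcore
  obtain ⟨i, t, hit⟩ : ∃ i t, f v = .inr ⟨i, t⟩ := by
    rcases h : f v with y | ⟨i, t⟩
    · exact (hv y h).elim
    · exact ⟨i, t, rfl⟩
  right
  refine ⟨i, ?_⟩
  have := hom_localized hH (G := (glue φ E).graph) (f := f) hf
    (Set.range fun t => .inr ⟨i, t⟩) (Set.range fun a => .inl (φ i a))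
    (Sum.elim (Function.extend (φ i) (κ i) fun _ => false) fun _ => false)
    (by
      rintro _ ⟨a, rfl⟩ _ ⟨b, rfl⟩ h
      simp only [Sum.elim_inl, (φ i).injective.extend_apply]
      exact (κ i).valid ((φ i).map_rel_iff.1 ((glue φ E).adj_inl.1 h)))
    (by
      rintro _ ⟨t, rfl⟩ b hb hb' h
      obtain ⟨w | w, rfl⟩ := glue_adj_inr h
      · exact hb' ⟨w, rfl⟩
      · exact hb ⟨w, rfl⟩)
  rcases this with h | h
  · obtain ⟨a, ha⟩ := h v ⟨t, hit.symm⟩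
    simp [hit] at ha
  · intro w
    rcases h w with ⟨t, ht⟩ | ⟨a, ha⟩
    · exact ⟨.inr t, ht.symm⟩
    · exact ⟨.inl a, ha.symm⟩

theorem glue_realizes_piece {H : SimpleGraph β} {c : Sym2 (Y ⊕ (Σ i, (E i).Inner)) → Fin r}
    (hc : MonoFree H (glue φ E).graph c) (i : ι) :
    MonoFree H (E i).graph (c ∘ Sym2.map (glueMap φ E i)) :=
  hc.pullback _ (glueMap_injective i) fun _ _ => glue_adj_glueMap.2

/-- If every piece realizes its share of `γ₀`, then colourings of the core agreeing with `γ₀` on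
the frames extend to the pieces, uniformly, without monochromatic copies of `H` outside the
core. -/
theorem exists_glue_extend [Fintype β] [NeZero r] {H : SimpleGraph β}
    (hH : ThreeChromaticallyConnected H) (κ : ∀ i, (S i).Coloring Bool) (γ₀ : Sym2 Y → Fin r)
    (h : ∀ i, (E i).Realizes H (γ₀ ∘ Sym2.map (φ i))) :
    ∃ D : (Sym2 Y → Fin r) → Sym2 (Y ⊕ (Σ i, (E i).Inner)) → Fin r,
      (∀ γ a b, D γ s(.inl a, .inl b) = γ s(a, b)) ∧
      (∀ γ γ' a t, D γ s(a, .inr t) = D γ' s(a, .inr t)) ∧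
      ∀ γ, (∀ i a b, (S i).Adj a b → γ s(φ i a, φ i b) = γ₀ s(φ i a, φ i b)) →
        ∀ f k, IsMono H (glue φ E).graph (D γ) f k → ∀ v, ∃ y, f v = .inl y := by
  classical
  choose c hc hcγ using h
  let D : (Sym2 Y → Fin r) → Sym2 (Y ⊕ (Σ i, (E i).Inner)) → Fin r := fun γ t =>
    if h : ∃ y, t = Sym2.map .inl y then γ h.choose
    else if h : ∃ p : Σ i, Sym2 (σ i ⊕ (E i).Inner), t = Sym2.map (glueMap φ E p.1) p.2 then
      c h.choose.1 h.choose.2 else 0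
  have hD : ∀ γ a b, D γ s(.inl a, .inl b) = γ s(a, b) := by
    intro γ a b
    have h : ∃ y : Sym2 Y, (s(.inl a, .inl b) : Sym2 (Y ⊕ (Σ i, (E i).Inner))) = Sym2.map .inl y :=
      ⟨s(a, b), rfl⟩
    have hy : h.choose = s(a, b) := Sym2.map.injective Sum.inl_injective h.choose_spec.symm
    simp only [D, dif_pos h, hy]
  have hncore : ∀ (a : Y ⊕ (Σ i, (E i).Inner)) t,
      ¬ ∃ y : Sym2 Y, s(a, .inr t) = Sym2.map .inl y := by
    rintro a t ⟨y, hy⟩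
    have : .inr t ∈ Sym2.map Sum.inl y := hy ▸ Sym2.mem_mk_right _ _
    simp [Sym2.mem_map] at this
  have hD' : ∀ γ i v t, D γ s(glueMap φ E i v, .inr ⟨i, t⟩) = c i s(v, .inr t) := by
    intro γ i v t
    have h : ∃ p : Σ i, Sym2 (σ i ⊕ (E i).Inner),
        s(glueMap φ E i v, .inr ⟨i, t⟩) = Sym2.map (glueMap φ E p.1) p.2 :=
      ⟨⟨i, s(v, .inr t)⟩, rfl⟩
    have hp : h.choose = ⟨i, s(v, .inr t)⟩ := by
      have hspec := h.choose_spec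
      generalize h.choose = p at hspec
      obtain ⟨j, p⟩ := p
      have hmem : .inr ⟨i, t⟩ ∈ Sym2.map (glueMap φ E j) p := hspec ▸ Sym2.mem_mk_right _ _
      obtain ⟨w | w, -, hw⟩ := Sym2.mem_map.1 hmem
      · cases hw
      · simp only [glueMap_inr, Sum.inr.injEq, Sigma.mk.injEq] at hw
        obtain ⟨rfl, _⟩ := hw
        congr 1
        exact Sym2.map.injective (glueMap_injective j) hspec.symm
    simp only [D, dif_neg (hncore _ _), dif_pos h]
    rw [hp]
  refine ⟨D, hD, fun γ γ' a t => by simp only [D, dif_neg (hncore a t)], fun γ hγ f k hf => ?_⟩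
  refine (glue_hom_localized hH κ hf.adj).resolve_right ?_
  rintro ⟨i, hi⟩
  choose g hg using hi
  have hcol : ∀ {v w}, (E i).graph.Adj v w →
      D γ s(glueMap φ E i v, glueMap φ E i w) = c i s(v, w) := by
    rintro (a | s) (b | t) hvw
    · rw [(E i).adj_inl] at hvw
      rw [glueMap_inl, glueMap_inl, hD, hγ i a b hvw, hcγ i hvw]
      rfl
    · exact hD' _ _ _ _
    · rw [Sym2.eq_swap, Sym2.eq_swap (a := Sum.inr s)]
      exact hD' _ _ _ _
    · exact hD' _ _ _ _
  have hadj : ∀ {u v}, H.Adj u v → (E i).graph.Adj (g u) (g v) := fun {u v} huv =>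
    glue_adj_glueMap.1 (by rw [← hg, ← hg]; exact hf.adj huv)
  refine hc i g k ⟨fun u v huv => hf.inj (by rw [hg, hg, huv]), hadj, fun {u v} huv => ?_⟩
  rw [← hcol (hadj huv), ← hg, ← hg, hf.col huv]

/-- A monochromatic copy inside the core of an extension gives one in the frame. -/
theorem Extension.isMono_core {σ : Type} {S : SimpleGraph σ} {E : Extension S} {H : SimpleGraph β}
    {c : Sym2 (σ ⊕ E.Inner) → Fin r} {f : β → σ ⊕ E.Inner} {k : Fin r}
    (hf : IsMono H E.graph c f k) {g : β → σ} (hg : ∀ v, f v = .inl (g v)) :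
    IsMono H S (c ∘ Sym2.map .inl) g k where
  inj u v huv := hf.inj (by rw [hg, hg, huv])
  adj huv := E.adj_inl.1 (by simpa only [← hg] using hf.adj huv)
  col huv := by simpa [← hg] using hf.col huv

theorem glue_realizes [Fintype β] [NeZero r] {H : SimpleGraph β}
    (hH : ThreeChromaticallyConnected H) (κ : ∀ i, (S i).Coloring Bool) {γ : Sym2 Y → Fin r}
    (hγ : MonoFree H C γ) (h : ∀ i, (E i).Realizes H (γ ∘ Sym2.map (φ i))) :
    (glue φ E).Realizes H γ := by
  obtain ⟨D, hD, -, hcore⟩ := exists_glue_extend hH κ γ h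
  refine ⟨D γ, fun f k hf => ?_, fun _ => hD _ _ _⟩
  choose g hg using hcore γ (fun _ _ _ _ => rfl) f k hf
  have := Extension.isMono_core hf hg
  refine hγ g k ⟨this.inj, this.adj, fun huv => (hD γ _ _).symm.trans (this.col huv)⟩

theorem Extension.Realizes.of_glue {H : SimpleGraph β} {γ : Sym2 Y → Fin r}
    (h : (glue φ E).Realizes H γ) (i : ι) : (E i).Realizes H (γ ∘ Sym2.map (φ i)) := by
  obtain ⟨c, hc, hγ⟩ := h
  exact ⟨_, glue_realizes_piece hc i, fun {a b} hab => hγ ((φ i).map_rel_iff.2 hab)⟩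

end Glue

theorem monoFree_of_coloring [Fintype β] {H : SimpleGraph β} (hH : ThreeChromaticallyConnected H)
    {G : SimpleGraph V} (κ : G.Coloring Bool) (c : Sym2 V → Fin r) : MonoFree H G c :=
  fun f _ hf => not_two_colorable hH (κ ∘ f) fun _ _ h => κ.valid (hf.adj h)

end Extensions

section Stars

variable {α V Z β : Type} {r : ℕ}

section Ramsey

theorem exists_embedding_const {X : Type} [Fintype X] {M : ℕ} (hM : r * Fintype.card X ≤ M)
    [NeZero r] (x : Fin M → Fin r) : ∃ (ε : X ↪ Fin M) (k : Fin r), ∀ t, x (ε t) = k := by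
  obtain ⟨k, hk⟩ := Fintype.exists_le_card_fiber_of_mul_le_card x (n := Fintype.card X) (by simpa)
  rw [← Fintype.card_subtype] at hk
  obtain ⟨ε⟩ := Function.Embedding.nonempty_of_card_le hk
  exact ⟨ε.trans (Function.Embedding.subtype _), k, fun t => (ε t).2⟩

/-- Every colouring of a large complete graph has a long sequence of vertices in which the colour
of an edge depends only on its first endpoint. -/
theorem exists_sequence_color_left (r m : ℕ) [NeZero r] : ∃ N, ∀ (α : Type) [Fintype α],
    N ≤ Fintype.card α → ∀ c : Sym2 α → Fin r, ∃ v : Fin m → α, Function.Injective v ∧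
      ∃ d : Fin m → Fin r, ∀ i j, i < j → c s(v i, v j) = d i := by
  induction m with
  | zero => exact ⟨0, fun α _ _ c => ⟨nofun, nofun, nofun, nofun⟩⟩
  | succ m ih =>
    obtain ⟨N, hN⟩ := ih
    refine ⟨r * N + 1, fun α _ hα c => ?_⟩
    classical
    obtain ⟨a⟩ : Nonempty α := Fintype.card_pos_iff.1 (by omega)
    obtain ⟨k, -, hk⟩ := Finset.exists_le_card_fiber_of_mul_le_card_of_maps_to
      (s := Finset.univ.erase a) (t := (Finset.univ : Finset (Fin r))) (f := fun b => c s(a, b))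
      (n := N) (by simp) Finset.univ_nonempty
      (by rw [Finset.card_erase_of_mem (Finset.mem_univ _)]; simp; omega)
    obtain ⟨v, hv, d, hd⟩ := hN {b // b ∈ (Finset.univ.erase a).filter fun b => c s(a, b) = k}
      (by rwa [Fintype.card_coe]) (c ∘ Sym2.map Subtype.val)
    have hmem : ∀ i, (v i : α) ≠ a ∧ c s(a, v i) = k := fun i => by
      have := (v i).2
      rw [Finset.mem_filter, Finset.mem_erase] at this
      exact ⟨this.1.1, this.2⟩
    refine ⟨Fin.cons a fun i => v i, ?_, Fin.cons k d, ?_⟩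
    · rw [Fin.cons_injective_iff]
      refine ⟨?_, Subtype.val_injective.comp hv⟩
      rintro ⟨i, hi⟩
      exact (hmem i).1 hi
    · intro i j hij
      induction j using Fin.cases with
      | zero => simp at hij
      | succ j =>
        induction i using Fin.cases with
        | zero => simpa using (hmem j).2
        | succ i => simpa using hd i j (by simpa using hij)

/-- Ramsey's theorem for graphs. -/
theorem exists_arrows_top [Fintype β] (H : SimpleGraph β) (r : ℕ) [NeZero r] :
    ∃ N, Arrows (⊤ : SimpleGraph (Fin N)) H r := by
  obtain ⟨N, hN⟩ := exists_sequence_color_left r (r * Fintype.card β)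
  refine ⟨N, fun c => ?_⟩
  obtain ⟨v, hv, d, hd⟩ := hN (Fin N) (by simp) c
  obtain ⟨ε, k, hε⟩ := exists_embedding_const le_rfl (X := β) d
  refine ⟨v ∘ ε, hv.comp ε.injective, k, fun a b hab => ⟨?_, ?_⟩⟩
  · exact (hv.comp ε.injective).ne hab.ne
  · rcases lt_or_gt_of_ne (ε.injective.ne hab.ne) with h | h
    · simp [hd _ _ h, hε]
    · rw [Sym2.eq_swap]
      simp [hd _ _ h, hε]

end Ramsey

theorem exists_star_nonconstant [Fintype β] {H : SimpleGraph β}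
    (hH : ThreeChromaticallyConnected H) (hr : 2 ≤ r) :
    ∃ (n : ℕ) (A : SimpleGraph (Fin n)) (u : Fin n), (∃ c : Sym2 (Fin n) → Fin r, MonoFree H A c) ∧
      ∀ c : Sym2 (Fin n) → Fin r, MonoFree H A c → ¬ ∃ k, ∀ y, A.Adj u y → c s(u, y) = k := by
  have : NeZero r := ⟨by omega⟩
  obtain ⟨n, hn⟩ := exists_arrows_top H r
  obtain ⟨G, hG⟩ := exists_minimal_of_wellFoundedLT
    (fun G : SimpleGraph (Fin n) => Arrows G H r) ⟨_, hn⟩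
  obtain ⟨p, q, hpq⟩ := exists_adj hH
  obtain ⟨f₀, -, k₀, hf₀⟩ := hG.prop 0
  obtain ⟨u, x, hux⟩ : ∃ u x, G.Adj u x := ⟨_, _, (hf₀ p q hpq).1⟩
  have hdel : ¬ Arrows (G.deleteEdges {s(u, x)}) H r := by
    intro h
    have := hG.le_of_le h (SimpleGraph.deleteEdges_le _) hux
    simp at this
  rw [arrows_iff] at hdel
  push Not at hdel
  refine ⟨n, G.deleteEdges {s(u, x)}, u, hdel, ?_⟩
  rintro c hc ⟨k, hk⟩
  have : Nontrivial (Fin r) := Fin.nontrivial_iff_two_le.2 hr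
  obtain ⟨k', hk'⟩ := exists_ne k
  classical
  obtain ⟨f, l, hf⟩ : ∃ f l, IsMono H G (Function.update c s(u, x) k') f l := by
    have := (arrows_iff G H).1 hG.prop (Function.update c s(u, x) k')
    simpa [MonoFree] using this
  have hedge : ∃ a b, H.Adj a b ∧ f a = u ∧ f b = x := by
    by_contra! hno
    have hne : ∀ {a b}, H.Adj a b → s(f a, f b) ≠ s(u, x) := by
      intro a b hab h
      rcases Sym2.eq_iff.1 h with ⟨h1, h2⟩ | ⟨h1, h2⟩
      · exact hno a b hab h1 h2
      · exact hno b a hab.symm h2 h1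
    refine hc f l ⟨hf.inj, fun hab => ?_, fun hab => ?_⟩
    · simpa [SimpleGraph.deleteEdges_adj, hf.adj hab] using hne hab
    · rw [← hf.col hab, Function.update_of_ne (hne hab)]
  obtain ⟨a, b, hab, rfl, rfl⟩ := hedge
  obtain ⟨b', hb', hab'⟩ := exists_other_neighbor hH hab
  have hne : s(f a, f b') ≠ s(f a, f b) := by
    rw [Ne, Sym2.congr_right, hf.inj.eq_iff]
    exact hb'
  have h1 := hf.col hab
  have h2 := hf.col hab'
  rw [Function.update_self] at h1
  rw [Function.update_of_ne hne, hk _ (by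
    simp only [SimpleGraph.deleteEdges_adj, Set.mem_singleton_iff]
    exact ⟨hf.adj hab', hne⟩)] at h2
  exact hk' (h1.trans h2.symm)

section Star

/-- The star with centre `none` and leaves `some t`. -/
def star (X : Type) : SimpleGraph (Option X) where
  Adj a b := a.isSome ≠ b.isSome
  symm := ⟨fun _ _ h => h.symm⟩
  loopless := ⟨fun _ h => h rfl⟩

variable {X Y : Type}

@[simp] theorem star_adj_none_some {t : X} : (star X).Adj none (some t) := by simp [star]

/-- The bipartition of a star. -/
def starColoring (X : Type) : (star X).Coloring Bool := SimpleGraph.Coloring.mk Option.isSome id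

/-- The embedding of stars induced by an embedding of the leaves. -/
def starEmbedding (ε : X ↪ Y) : star X ↪g star Y where
  toEmbedding := ε.optionMap
  map_rel_iff' := by simp [star]

/-- The star colouring `x` extends to `E` without a monochromatic copy of `H`. -/
def Extension.StarRealizes (E : Extension (star X)) (H : SimpleGraph β) (x : X → Fin r) : Prop :=
  ∃ c, MonoFree H E.graph c ∧ ∀ t, c s(.inl none, .inl (some t)) = x t

theorem Extension.realizes_iff_starRealizes {E : Extension (star X)} {H : SimpleGraph β}
    {γ : Sym2 (Option X) → Fin r} :
    E.Realizes H γ ↔ E.StarRealizes H fun t => γ s(none, some t) := by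
  refine exists_congr fun c => and_congr_right fun _ => ⟨fun h t => h star_adj_none_some, ?_⟩
  rintro h (_ | a) (_ | b) hab
  · simp [star] at hab
  · exact h b
  · rw [Sym2.eq_swap, h a, Sym2.eq_swap]
  · simp [star] at hab

theorem exists_star_color [NeZero r] (x : X → Fin r) :
    ∃ γ : Sym2 (Option X) → Fin r, ∀ t, γ s(none, some t) = x t :=
  ⟨Sym2.lift ⟨fun a b => match a, b with
    | none, some t => x t
    | some t, none => x t
    | _, _ => 0, by rintro (_ | a) (_ | b) <;> rfl⟩, fun _ => rfl⟩

/-- Glue extensions of stars along their common centre, identifying leaves. -/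
abbrev starGlue {ι : Type} [Finite ι] {X : ι → Type} (ε : ∀ i, X i ↪ Y)
    (E : ∀ i, Extension (star (X i))) : Extension (star Y) :=
  glue (fun i => starEmbedding (ε i)) E

theorem starGlue_starRealizes [Fintype β] [NeZero r] {H : SimpleGraph β}
    (hH : ThreeChromaticallyConnected H) {ι : Type} [Finite ι] {X : ι → Type} {ε : ∀ i, X i ↪ Y}
    {E : ∀ i, Extension (star (X i))} {x : Y → Fin r} :
    (starGlue ε E).StarRealizes H x ↔ ∀ i, (E i).StarRealizes H (x ∘ ε i) := by
  obtain ⟨γ, hγ⟩ := exists_star_color x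
  obtain rfl : (fun t => γ s(none, some t)) = x := funext hγ
  rw [← Extension.realizes_iff_starRealizes]
  have : ∀ i, (E i).StarRealizes H ((fun t => γ s(none, some t)) ∘ ε i) ↔
      (E i).Realizes H (γ ∘ Sym2.map (starEmbedding (ε i))) := fun i => by
    rw [Extension.realizes_iff_starRealizes]
    rfl
  simp only [this]
  exact ⟨fun h i => h.of_glue i, glue_realizes hH (fun i => starColoring _)
    (monoFree_of_coloring hH (starColoring _) γ)⟩

/-- A vertex with an independent set of neighbours spans an induced star. -/
def starEmbeddingAt {A : SimpleGraph V} (u : V) (ε : X ↪ V) (hu : ∀ t, A.Adj u (ε t))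
    (hε : ∀ s t, ¬ A.Adj (ε s) (ε t)) : star X ↪g A where
  toFun := fun a => a.elim u ε
  inj' := by
    rintro (_ | a) (_ | b) h
    · rfl
    · exact ((hu b).ne h).elim
    · exact ((hu a).ne h.symm).elim
    · exact congrArg some (ε.injective h)
  map_rel_iff' := by
    rintro (_ | a) (_ | b)
    · simp [star]
    · exact iff_of_true (hu b) (by simp [star])
    · exact iff_of_true (hu a).symm (by simp [star])
    · exact iff_of_false (hε a b) (by simp [star])

theorem Extension.ofEmbedding_starRealizes [Finite V] {A : SimpleGraph V} (j : star X ↪g A)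
    {H : SimpleGraph β} [NeZero r] {x : X → Fin r} :
    (Extension.ofEmbedding A j).StarRealizes H x ↔
      ∃ c, MonoFree H A c ∧ ∀ t, c s(j none, j (some t)) = x t := by
  obtain ⟨γ, hγ⟩ := exists_star_color x
  obtain rfl : (fun t => γ s(none, some t)) = x := funext hγ
  rw [← Extension.realizes_iff_starRealizes, Extension.ofEmbedding_realizes]
  refine exists_congr fun c => and_congr_right fun _ => ⟨fun h t => h star_adj_none_some, ?_⟩
  rintro h (_ | a) (_ | b) hab
  · simp [star] at hab
  · exact h b
  · rw [Sym2.eq_swap, h a, Sym2.eq_swap]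
  · simp [star] at hab

end Star

/-- The frame of an extension as an induced subgraph. -/
def Extension.inlEmbedding {σ : Type} {S : SimpleGraph σ} (E : Extension S) : S ↪g E.graph where
  toFun := Sum.inl
  inj' := Sum.inl_injective
  map_rel_iff' := E.adj_inl

/-- The same graph with a smaller frame. -/
abbrev Extension.restrict {σ τ : Type} [Finite σ] {S : SimpleGraph σ} {T : SimpleGraph τ}
    (E : Extension S) (j : T ↪g S) : Extension T :=
  Extension.ofEmbedding E.graph (E.inlEmbedding.comp j)

theorem Extension.restrict_realizes {σ τ : Type} [Finite σ] {S : SimpleGraph σ}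
    {T : SimpleGraph τ} {E : Extension S} {j : T ↪g S} {H : SimpleGraph β}
    {γ : Sym2 τ → Fin r} : (E.restrict j).Realizes H γ ↔
      ∃ γ', E.Realizes H γ' ∧ ∀ {a b}, T.Adj a b → γ' s(j a, j b) = γ s(a, b) := by
  rw [Extension.ofEmbedding_realizes]
  constructor
  · rintro ⟨c, hc, h⟩
    exact ⟨c ∘ Sym2.map .inl, ⟨c, hc, fun _ => rfl⟩, h⟩
  · rintro ⟨γ', ⟨c, hc, h'⟩, h⟩
    exact ⟨c, hc, fun hab => (h' (j.map_rel_iff.2 hab)).trans (h hab)⟩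

theorem Extension.restrict_starRealizes {X Y : Type} [Finite Y] [NeZero r]
    {E : Extension (star Y)} {ε : X ↪ Y} {H : SimpleGraph β} {x : X → Fin r} :
    (E.restrict (starEmbedding ε)).StarRealizes H x ↔
      ∃ y, E.StarRealizes H y ∧ y ∘ ε = x := by
  rw [Extension.ofEmbedding_starRealizes]
  constructor
  · rintro ⟨c, hc, h⟩
    exact ⟨fun t => c s(.inl none, .inl (some t)), ⟨c, hc, fun _ => rfl⟩, funext h⟩
  · rintro ⟨y, ⟨c, hc, h⟩, rfl⟩
    exact ⟨c, hc, fun t => h (ε t)⟩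

end Stars

section Gadgets

variable {V β : Type} {r : ℕ} [Fintype β] {H : SimpleGraph β}

section NegativeSender

/-- Every satisfiable extension of a star with two leaves can give both leaves the same colour. -/
def NoNegativeSender (H : SimpleGraph β) (r : ℕ) : Prop :=
  ∀ E : Extension (star Bool), (∃ x : Bool → Fin r, E.StarRealizes H x) →
    ∃ x : Bool → Fin r, E.StarRealizes H x ∧ x true = x false

theorem NoNegativeSender.exists_common [NeZero r] (hH : ThreeChromaticallyConnected H)
    (hP : NoNegativeSender H r) (X : Type) [Finite X] :
    ∀ E : Bool → Extension (star X), (∀ b, ∃ x : X → Fin r, (E b).StarRealizes H x) →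
      ∃ x : X → Fin r, ∀ b, (E b).StarRealizes H x := by
  have hX : Finite X := inferInstance
  revert hX
  induction X using Finite.induction_empty_option with
  | of_equiv e ih =>
    intro hY E hE
    obtain ⟨x, hx⟩ := ih (Finite.of_equiv _ e.symm)
        (fun b => (E b).restrict (starEmbedding e.toEmbedding)) fun b => by
      obtain ⟨y, hy⟩ := hE b
      exact ⟨_, Extension.restrict_starRealizes.2 ⟨y, hy, rfl⟩⟩
    refine ⟨x ∘ e.symm, fun b => ?_⟩
    obtain ⟨y, hy, hyx⟩ := Extension.restrict_starRealizes.1 (hx b)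
    rw [← hyx]
    convert hy
    ext t
    simp
  | h_empty =>
    intro _ E hE
    choose x hx using hE
    refine ⟨x true, fun b => ?_⟩
    rw [Subsingleton.elim (x true) (x b)]
    exact hx b
  | h_option ih =>
    rename_i X _
    intro _ E hE
    obtain ⟨x, hx⟩ := ih inferInstance
        (fun b => (E b).restrict (starEmbedding Function.Embedding.some)) fun b => by
      obtain ⟨y, hy⟩ := hE b
      exact ⟨_, Extension.restrict_starRealizes.2 ⟨y, hy, rfl⟩⟩
    choose y hy hyx using fun b => Extension.restrict_starRealizes.1 (hx b)
    let ε : Bool → Option X ↪ X ⊕ Bool := fun b =>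
      ⟨fun a => a.elim (.inr b) .inl, by rintro (_ | s) (_ | t) h <;> simp_all⟩
    obtain ⟨w, hw, hwb⟩ := hP ((starGlue ε E).restrict (starEmbedding Function.Embedding.inr)) (by
      refine ⟨_, Extension.restrict_starRealizes.2
        ⟨Sum.elim x fun b => y b none, (starGlue_starRealizes hH).2 fun b => ?_, rfl⟩⟩
      convert hy b
      ext (_ | t)
      · rfl
      · exact congrArg Fin.val (congrFun (hyx b) t).symm)
    obtain ⟨z, hz, rfl⟩ := Extension.restrict_starRealizes.1 hw
    rw [starGlue_starRealizes hH] at hz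
    refine ⟨z ∘ ε true, fun b => ?_⟩
    convert hz b using 1
    cases b
    · ext (_ | t)
      · exact congrArg Fin.val hwb
      · rfl
    · rfl

theorem NoNegativeSender.exists_constant [NeZero r] (hH : ThreeChromaticallyConnected H)
    (hP : NoNegativeSender H r) {X : Type} [Fintype X] {E : Extension (star X)}
    (hE : ∃ x : X → Fin r, E.StarRealizes H x) :
    ∃ k : Fin r, E.StarRealizes H fun _ => k := by
  classical
  obtain ⟨x₀, hx₀⟩ := hE
  have key : ∀ s : Finset (X ↪ Fin (r * Fintype.card X)),
      ∃ x : Fin (r * Fintype.card X) → Fin r, ∀ ε ∈ s, E.StarRealizes H (x ∘ ε) := by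
    intro s
    induction s using Finset.induction_on with
    | empty => exact ⟨0, by simp⟩
    | insert ε₀ s _ ih =>
      obtain ⟨x, hx⟩ := ih
      obtain ⟨y, hy⟩ := hP.exists_common hH _
        (fun b => bif b then starGlue (fun ε : s => ε.1) fun _ => E
          else starGlue (fun _ : Unit => ε₀) fun _ => E) (by
        rintro (_ | _)
        · refine ⟨Function.extend ε₀ x₀ 0, (starGlue_starRealizes hH).2 fun _ => ?_⟩
          rwa [Function.extend_comp ε₀.injective]
        · exact ⟨x, (starGlue_starRealizes hH).2 fun ε => hx ε ε.2⟩)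
      refine ⟨y, fun ε hε => ?_⟩
      rcases Finset.mem_insert.1 hε with rfl | hε
      · exact (starGlue_starRealizes hH).1 (hy false) ()
      · exact (starGlue_starRealizes hH).1 (hy true) ⟨ε, hε⟩
  obtain ⟨x, hx⟩ := key Finset.univ
  obtain ⟨ε, k, hk⟩ := exists_embedding_const le_rfl x
  refine ⟨k, ?_⟩
  convert hx ε (Finset.mem_univ _)
  exact (hk _).symm

theorem NoNegativeSender.exists_constant_classes [NeZero r] (hH : ThreeChromaticallyConnected H)
    (hP : NoNegativeSender H r) {Λ : Type} (T : Finset Λ) :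
    ∀ (V : Type) [Finite V] (A : SimpleGraph V) (u : V) (l : V → Λ),
      (∀ a b, A.Adj a b → l a ≠ l b) → (∃ c : Sym2 V → Fin r, MonoFree H A c) →
      ∃ c : Sym2 V → Fin r, MonoFree H A c ∧
        ∀ t ∈ T, ∃ k, ∀ y, A.Adj u y → l y = t → c s(u, y) = k := by
  classical
  induction T using Finset.induction_on with
  | empty =>
    rintro V _ A u l - ⟨c, hc⟩
    exact ⟨c, hc, by simp⟩
  | insert t T _ ih =>
    rintro V _ A u l hl ⟨c, hc⟩
    by_cases ht : l u = t
    · obtain ⟨c, hc, hT⟩ := ih V A u l hl ⟨c, hc⟩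
      refine ⟨c, hc, fun t' ht' => ?_⟩
      rcases Finset.mem_insert.1 ht' with rfl | ht'
      · exact ⟨0, fun y hy hyt => (hl u y hy (ht.trans hyt.symm)).elim⟩
      · exact hT t' ht'
    let X := {y // A.Adj u y ∧ l y = t}
    have : Fintype X := Fintype.ofFinite _
    let j : star X ↪g A := starEmbeddingAt u (Function.Embedding.subtype _) (fun y => y.2.1)
      fun y z hyz => hl _ _ hyz (y.2.2.trans z.2.2.symm)
    let E := Extension.ofEmbedding A j
    have hE : ∀ {x : X → Fin r}, E.StarRealizes H x ↔ _ := Extension.ofEmbedding_starRealizes j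
    obtain ⟨k, hk⟩ := hP.exists_constant hH (E := E) ⟨_, hE.2 ⟨c, hc, fun _ => rfl⟩⟩
    let e : _ ≃ V := Extension.ofEmbeddingEquiv j
    let M := r * Fintype.card X
    let G := starGlue (fun ε : X ↪ Fin M => ε) fun _ => E
    let l' : Option (Fin M) ⊕ (Σ _ : X ↪ Fin M, E.Inner) → Λ :=
      Sum.elim (fun a => a.elim (l u) fun _ => t) fun p => l p.2
    have hl' : ∀ ε w, l' (glueMap (fun ε : X ↪ Fin M => starEmbedding ε) (fun _ => E) ε w) =
        l (e w) := by
      rintro ε ((_ | y) | w)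
      · rfl
      · exact y.2.2.symm
      · rfl
    obtain ⟨c', hc', hT⟩ := ih _ G.graph (.inl none) l' (by
      rintro a b (⟨p, q, h, rfl, rfl⟩ | ⟨ε, v, w, h, rfl, rfl⟩)
      · rcases p with _ | p <;> rcases q with _ | q
        · simp [star] at h
        · exact ht
        · exact Ne.symm ht
        · simp [star] at h
      · rw [hl', hl']
        exact hl _ _ h) (by
      obtain ⟨c, hc, -⟩ : G.StarRealizes H fun _ => k := (starGlue_starRealizes hH).2 fun _ => hk
      exact ⟨c, hc⟩)
    obtain ⟨ε, k', hε⟩ := exists_embedding_const le_rfl fun i => c' s(.inl none, .inl (some i))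
    have hθ : ∀ {a b}, A.Adj a b → G.graph.Adj
        (glueMap (fun ε : X ↪ Fin M => starEmbedding ε) (fun _ => E) ε (e.symm a))
        (glueMap (fun ε : X ↪ Fin M => starEmbedding ε) (fun _ => E) ε (e.symm b)) := by
      intro a b hab
      rw [glue_adj_glueMap]
      change A.Adj (e _) (e _)
      simpa using hab
    have hu : e.symm u = .inl none := e.symm_apply_eq.2 rfl
    refine ⟨c' ∘ Sym2.map fun v => glueMap _ _ ε (e.symm v),
      hc'.pullback _ ((glueMap_injective ε).comp e.symm.injective) fun a b => hθ, ?_⟩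
    intro t' ht'
    rcases Finset.mem_insert.1 ht' with rfl | ht'
    · refine ⟨k', fun y hy hyt => ?_⟩
      have hy' : e.symm y = .inl (some ⟨y, hy, hyt⟩) := e.symm_apply_eq.2 rfl
      rw [← hε ⟨y, hy, hyt⟩, Function.comp_apply, Sym2.map_mk, hu, hy']
      rfl
    · obtain ⟨k'', hk''⟩ := hT t' ht'
      refine ⟨k'', fun y hy hyt => ?_⟩
      have h := hθ hy
      rw [hu] at h
      rw [← hk'' _ h (by rw [hl', e.apply_symm_apply, hyt]), Function.comp_apply, Sym2.map_mk, hu]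
      rfl

theorem not_noNegativeSender (hH : ThreeChromaticallyConnected H) (hr : 2 ≤ r) :
    ¬ NoNegativeSender H r := by
  intro hP
  have : NeZero r := ⟨by omega⟩
  obtain ⟨n, A, u, ⟨c, hc⟩, hA⟩ := exists_star_nonconstant hH hr
  let j : star Empty ↪g A := starEmbeddingAt u ⟨nofun, nofun⟩ nofun nofun
  let E := Extension.ofEmbedding A j
  let e : _ ≃ Fin n := Extension.ofEmbeddingEquiv j
  let N := r * Fintype.card (Fin n)
  let G := starGlue (fun _ : Fin n ↪ Fin N => Function.Embedding.refl Empty) fun _ => E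
  let l : Option Empty ⊕ (Σ _ : Fin n ↪ Fin N, E.Inner) → Option (Fin N) :=
    Sum.elim (fun _ => none) fun p => some (p.1 p.2)
  have hu : e.symm u = .inl none := e.symm_apply_eq.2 rfl
  have hl : ∀ ε w, l (glueMap (fun _ : Fin n ↪ Fin N => starEmbedding (.refl Empty))
      (fun _ => E) ε w) = if e w = u then none else some (ε (e w)) := by
    rintro ε ((_ | ⟨⟨⟩⟩) | w)
    · exact (if_pos rfl).symm
    · refine (if_neg fun h => ?_).symm
      rw [← e.eq_symm_apply, hu] at h
      cases h
  obtain ⟨d, hd, hT⟩ := hP.exists_constant_classes hH Finset.univ _ G.graph (.inl none) l (by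
      rintro a b (⟨_ | ⟨⟨⟩⟩, _ | ⟨⟨⟩⟩, h, rfl, rfl⟩ | ⟨ε, v, w, h, rfl, rfl⟩)
      · simp [star] at h
      · rw [hl, hl]
        have hvw : e v ≠ e w := e.injective.ne h.ne
        split_ifs with h1 h2 h2
        · exact (hvw (h1.trans h2.symm)).elim
        · simp
        · simp
        · simpa using hvw) (by
      obtain ⟨d, hd, -⟩ : G.StarRealizes H (nofun : Empty → Fin r) :=
        (starGlue_starRealizes hH).2 fun _ =>
          (Extension.ofEmbedding_starRealizes j).2 ⟨c, hc, nofun⟩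
      exact ⟨d, hd⟩)
  choose k hk using fun t => hT t (Finset.mem_univ t)
  obtain ⟨ε, k', hε⟩ := exists_embedding_const le_rfl (fun i : Fin N => k (some i)) (X := Fin n)
  have hθ : ∀ {a b}, A.Adj a b → G.graph.Adj
      (glueMap (fun _ : Fin n ↪ Fin N => starEmbedding (.refl Empty)) (fun _ => E) ε (e.symm a))
      (glueMap (fun _ : Fin n ↪ Fin N => starEmbedding (.refl Empty)) (fun _ => E) ε
        (e.symm b)) := by
    intro a b hab
    rw [glue_adj_glueMap]
    change A.Adj (e _) (e _)
    simpa using hab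
  refine hA _ (hd.pullback (fun v => glueMap _ _ ε (e.symm v))
    ((glueMap_injective ε).comp e.symm.injective) fun a b => hθ) ⟨k', fun y hy => ?_⟩
  have h := hθ hy
  rw [hu] at h
  rw [← hε y, Function.comp_apply, Sym2.map_mk, hu]
  exact hk _ _ h (by rw [hl, e.apply_symm_apply, if_neg hy.ne.symm])

/-- A gadget forcing two edges with a common vertex to have different colours. -/
theorem exists_ne_extension (hH : ThreeChromaticallyConnected H) (hr : 2 ≤ r) :
    ∃ E : Extension (star Bool), ∀ x : Bool → Fin r,
      E.StarRealizes H x ↔ x true ≠ x false := by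
  have := not_noNegativeSender hH hr
  simp only [NoNegativeSender] at this
  push Not at this
  obtain ⟨E, ⟨x₀, hx₀⟩, hE⟩ := this
  refine ⟨E, fun x => ⟨hE x, fun hx => ?_⟩⟩
  let π := Equiv.swap (x₀ true) (x true)
  let π' := Equiv.swap (π (x₀ false)) (x false)
  have h1 : π' (π (x₀ true)) = x true := by
    have h : π (x₀ true) = x true := Equiv.swap_apply_left _ _
    rw [h]
    refine Equiv.swap_apply_of_ne_of_ne (fun h' => ?_) hx
    exact hE x₀ hx₀ (π.injective (h.trans h'))
  have h2 : π' (π (x₀ false)) = x false := Equiv.swap_apply_left _ _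
  obtain ⟨c, hc, h⟩ := hx₀
  refine ⟨π' ∘ π ∘ c, fun f k hf => hc f (π.symm (π'.symm k)) ⟨hf.inj, hf.adj, fun huv => ?_⟩, ?_⟩
  · rw [Equiv.eq_symm_apply, Equiv.eq_symm_apply]
    exact hf.col huv
  · rintro (_ | _) <;> simp only [Function.comp_apply, h, h1, h2]

end NegativeSender

section Equality

theorem exists_adjacent_eq_extension (hH : ThreeChromaticallyConnected H) (hr : 2 ≤ r) :
    ∃ E : Extension (star Bool), ∀ x : Bool → Fin r,
      E.StarRealizes H x ↔ x true = x false := by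
  have : NeZero r := ⟨by omega⟩
  obtain ⟨E, hE⟩ := exists_ne_extension hH hr
  let ι := {p : Option (Fin r) × Option (Fin r) //
    p.1 ≠ p.2 ∧ p.2 ≠ none ∧ ¬ (p.1 = none ∧ p.2 = some 0)}
  let ε : ι → Bool ↪ Option (Fin r) := fun p =>
    ⟨fun b => bif b then p.1.1 else p.1.2, by
      rintro (_ | _) (_ | _) h
      · rfl
      · exact (p.2.1 h.symm).elim
      · exact (p.2.1 h).elim
      · rfl⟩
  let δ : Bool ↪ Option (Fin r) := ⟨fun b => bif b then none else some 0, by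
      rintro (_ | _) (_ | _) h <;> simp_all⟩
  refine ⟨(starGlue ε fun _ => E).restrict (starEmbedding δ), fun w => ?_⟩
  rw [Extension.restrict_starRealizes]
  simp only [starGlue_starRealizes hH, hE]
  constructor
  · rintro ⟨x, hx, rfl⟩
    have hinj : Function.Injective (x ∘ some) := by
      intro a b hab
      by_contra hne
      exact hx ⟨(some a, some b), by simpa using hne⟩ hab
    obtain ⟨a, ha⟩ := Finite.surjective_of_injective hinj (x none)
    rcases eq_or_ne a 0 with rfl | ha0
    · exact ha.symm
    · exact (hx ⟨(none, some a), by simpa using ha0⟩ ha.symm).elim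
  · intro hw
    refine ⟨fun a => a.elim (w true) (Equiv.swap 0 (w true)), ?_, ?_⟩
    · rintro ⟨⟨a | a, b | b⟩, h⟩
      · simp at h
      · have hb : b ≠ 0 := by simpa using h
        change w true ≠ Equiv.swap 0 (w true) b
        intro h
        rw [← Equiv.swap_apply_eq_iff, Equiv.swap_apply_right] at h
        exact hb h.symm
      · simp at h
      · have hab : a ≠ b := by simpa using h
        exact (Equiv.swap 0 (w true)).injective.ne hab
    · ext (_ | _)
      · change (Equiv.swap 0 (w true) 0 : ℕ) = w false
        rw [Equiv.swap_apply_left, hw]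
      · rfl

/-- Two disjoint edges. -/
def twoEdges : SimpleGraph (Bool × Bool) where
  Adj a b := a.1 = b.1 ∧ a.2 ≠ b.2
  symm := ⟨fun _ _ h => ⟨h.1.symm, h.2.symm⟩⟩
  loopless := ⟨fun _ h => h.2 rfl⟩

/-- The bipartition of two disjoint edges. -/
def twoEdgesColoring : twoEdges.Coloring Bool := SimpleGraph.Coloring.mk Prod.snd fun h => h.2

/-- A gadget on two edges with a common vertex can be transferred to two disjoint edges. -/
theorem exists_twoEdges_extension (hH : ThreeChromaticallyConnected H) (hr : 2 ≤ r)
    {R : Fin r → Fin r → Prop} {E : Extension (star Bool)}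
    (hE : ∀ x : Bool → Fin r, E.StarRealizes H x ↔ R (x false) (x true)) :
    ∃ E' : Extension twoEdges, ∀ γ : Sym2 (Bool × Bool) → Fin r, E'.Realizes H γ ↔
      R (γ s((false, false), (false, true))) (γ s((true, false), (true, true))) := by
  have : NeZero r := ⟨by omega⟩
  obtain ⟨E₀, hE₀⟩ := exists_adjacent_eq_extension hH hr
  let P : SimpleGraph (Fin 5) := SimpleGraph.pathGraph 5
  let κ : P.Coloring Bool := SimpleGraph.Coloring.mk (fun i => i.val % 2 = 0) fun {i j} h => by
    simp only [P, SimpleGraph.pathGraph_adj] at h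
    simp
    omega
  let φ : Fin 3 → star Bool ↪g P := fun i => starEmbeddingAt ⟨i + 1, by omega⟩
    ⟨fun b => bif b then ⟨i + 2, by omega⟩ else ⟨i, by omega⟩, by
      rintro (_ | _) (_ | _) h <;> simp_all⟩
    (fun b => by
      change (SimpleGraph.pathGraph 5).Adj _ (bif b then _ else _)
      cases b <;> simp [SimpleGraph.pathGraph_adj])
    (fun a b => by
      change ¬ (SimpleGraph.pathGraph 5).Adj (bif a then _ else _) (bif b then _ else _)
      cases a <;> cases b <;> simp [SimpleGraph.pathGraph_adj] <;> omega)
  let v : Bool × Bool → Fin 5 := fun p =>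
    bif p.1 then (bif p.2 then 4 else 3) else bif p.2 then 1 else 0
  let j : twoEdges ↪g P :=
    { toFun := v
      inj' := by rintro ⟨_ | _, _ | _⟩ ⟨_ | _, _ | _⟩ h <;> simp_all [v]
      map_rel_iff' := by
        intro a b
        change (SimpleGraph.pathGraph 5).Adj (v a) (v b) ↔ _
        rcases a with ⟨_ | _, _ | _⟩ <;> rcases b with ⟨_ | _, _ | _⟩ <;>
          simp [v, SimpleGraph.pathGraph_adj, twoEdges] }
  refine ⟨(glue φ ![E₀, E₀, E]).restrict j, fun γ => ?_⟩
  rw [Extension.restrict_realizes]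
  constructor
  · rintro ⟨γ', h, hγ⟩
    have h0 : γ' s(1, 2) = γ' s(1, 0) :=
      (hE₀ _).1 (Extension.realizes_iff_starRealizes.1 (h.of_glue 0))
    have h1 : γ' s(2, 3) = γ' s(2, 1) :=
      (hE₀ _).1 (Extension.realizes_iff_starRealizes.1 (h.of_glue 1))
    have h2 : R (γ' s(3, 2)) (γ' s(3, 4)) :=
      (hE _).1 (Extension.realizes_iff_starRealizes.1 (h.of_glue 2))
    have h3 : γ' s(0, 1) = _ := hγ (a := (false, false)) (b := (false, true)) (by simp [twoEdges])
    have h4 : γ' s(3, 4) = _ := hγ (a := (true, false)) (b := (true, true)) (by simp [twoEdges])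
    rwa [Sym2.eq_swap, h1, Sym2.eq_swap, h0, Sym2.eq_swap, h3, h4] at h2
  · intro h
    let γ' : Sym2 (Fin 5) → Fin r := fun t =>
      if t = s(3, 4) then γ s((true, false), (true, true)) else γ s((false, false), (false, true))
    have hγ' : ∀ t, t ≠ s(3, 4) → γ' t = γ s((false, false), (false, true)) := fun t ht => if_neg ht
    have h34 : γ' s(3, 4) = γ s((true, false), (true, true)) := if_pos rfl
    refine ⟨γ', ?_, ?_⟩
    · refine glue_realizes hH (fun _ => starColoring _) (monoFree_of_coloring hH κ _) fun i => ?_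
      rw [Extension.realizes_iff_starRealizes]
      fin_cases i
      · refine (hE₀ _).2 ?_
        change γ' s(1, 2) = γ' s(1, 0)
        rw [hγ' _ (by decide), hγ' _ (by decide)]
      · refine (hE₀ _).2 ?_
        change γ' s(2, 3) = γ' s(2, 1)
        rw [hγ' _ (by decide), hγ' _ (by decide)]
      · refine (hE _).2 ?_
        change R (γ' s(3, 2)) (γ' s(3, 4))
        rwa [hγ' _ (by decide), h34]
    · rintro ⟨_ | _, _ | _⟩ ⟨_ | _, _ | _⟩ hab <;> simp [twoEdges] at hab
      · exact hγ' s(0, 1) (by decide)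
      · rw [Sym2.eq_swap (a := (false, true))]
        exact hγ' s(1, 0) (by decide)
      · exact h34
      · rw [Sym2.eq_swap, Sym2.eq_swap (a := (true, true))]
        exact h34

end Equality

end Gadgets

section Clauses

variable {V β : Type} {r s : ℕ}

/-- Colourings `C i` of `G` agreeing away from one vertex `x`, no two of which share a
monochromatic copy of `H`, combine to a colouring of the blowup. -/
theorem exists_blowup_color {H : SimpleGraph β} {G : SimpleGraph V} (hs : 2 ≤ s) (x : V)
    (C : Fin s → Sym2 V → Fin r)
    (hC : ∀ i j a b, (a = x ↔ b = x) → C i s(a, b) = C j s(a, b))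
    (hfree : ∀ i j f k, i ≠ j → IsMono H G (C i) f k → ¬ IsMono H G (C j) f k) :
    ∃ c : Sym2 (V × Fin s) → Fin r, ¬ HasMonoCanonCopy G H s 2 r c := by
  classical
  let c : Sym2 (V × Fin s) → Fin r := Sym2.lift
    ⟨fun a b => if a.1 = x then C a.2 s(a.1, b.1) else C b.2 s(a.1, b.1), by
      rintro ⟨a, i⟩ ⟨b, j⟩
      change ite _ _ _ = ite _ _ _
      rw [Sym2.eq_swap (a := b)]
      by_cases ha : a = x <;> by_cases hb : b = x
      · simpa only [ha, hb, if_true] using hC i j x x Iff.rfl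
      · simp only [ha, hb, if_true, if_false]
      · simp only [ha, hb, if_true, if_false]
      · simpa only [ha, hb, if_false] using hC j i a b (iff_of_false ha hb)⟩
  have hc : ∀ a b i j, c s((a, i), (b, j)) = if a = x then C i s(a, b) else C j s(a, b) :=
    fun _ _ _ _ => rfl
  refine ⟨c, ?_⟩
  rintro ⟨f, hf, g, hg, k, h⟩
  obtain ⟨i, j, hij, hi, hj⟩ : ∃ i j, i ≠ j ∧ IsMono H G (C i) f k ∧ IsMono H G (C j) f k := by
    by_cases hx : ∃ u, f u = x
    · obtain ⟨u, rfl⟩ := hx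
      have key : ∀ i, IsMono H G (C (g u i)) f k := by
        refine fun i => ⟨hf, fun hab => (h _ _ hab).1, fun {a b} hab => ?_⟩
        have hab' := (h _ _ hab).2 i i
        rw [hc] at hab'
        split_ifs at hab' with ha
        · rwa [hf ha] at hab' ⊢
        · by_cases hb : f b = f u
          · rwa [hf hb] at hab' ⊢
          · rw [← hab']
            exact hC _ _ _ _ (iff_of_false ha hb)
      exact ⟨_, _, (hg u).ne (show (0 : Fin 2) ≠ 1 by decide), key 0, key 1⟩
    · push Not at hx
      have key : ∀ i, IsMono H G (C i) f k := by
        refine fun i => ⟨hf, fun hab => (h _ _ hab).1, fun {a b} hab => ?_⟩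
        rw [← (h _ _ hab).2 0 0, hc, if_neg (hx a)]
        exact hC _ _ _ _ (iff_of_false (hx a) (hx b))
      exact ⟨⟨0, by omega⟩, ⟨1, by omega⟩, by simp, key _, key _⟩
  exact hfree i j f k hij hi hj

/-- An unsatisfiable system of clauses "`fst` and `snd` do not both have the value `col`", with
`s` assignments violating pairwise disjoint sets of clauses. -/
structure ClauseSystem (r s : ℕ) where
  Var : Type
  Clause : Type
  finite_var : Finite Var
  finite_clause : Finite Clause
  fst : Clause → Var
  snd : Clause → Option Var
  col : Clause → Fin r
  edge : Var → Var → Fin r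
  edge_symm : ∀ y z, edge y z = edge z y
  edge_eq : ∀ {κ y}, snd κ = some y → edge (fst κ) y = col κ
  eq_of_fst_eq : ∀ {κ κ'}, col κ = col κ' → fst κ = fst κ' → κ = κ'
  snd_ne : ∀ {κ κ'}, col κ = col κ' → snd κ' ≠ some (fst κ)
  unsat : ∀ χ : Var → Fin r, ∃ κ, χ (fst κ) = col κ ∧ ∀ y, snd κ = some y → χ y = col κ
  val : Fin s → Var → Fin r
  eq_of_violated : ∀ {i j κ}, val i (fst κ) = col κ → (∀ y, snd κ = some y → val i y = col κ) →
    val j (fst κ) = col κ → (∀ y, snd κ = some y → val j y = col κ) → i = j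

attribute [instance] ClauseSystem.finite_var ClauseSystem.finite_clause

theorem nonempty_clauseSystem (hr : 2 ≤ r) (s : ℕ) : Nonempty (ClauseSystem r s) := by
  have : Nontrivial (Fin r) := Fin.nontrivial_iff_two_le.2 hr
  obtain ⟨a, b, hab⟩ := exists_pair_ne (Fin r)
  obtain ⟨c, hc, hc2⟩ : ∃ c : ℕ → Fin r, (∀ j, c j ≠ c (j + 1)) ∧ ∀ j, c (j + 2) = c j := by
    refine ⟨fun j => if j % 2 = 0 then a else b, fun j => ?_, fun j => by simp⟩
    rcases Nat.mod_two_eq_zero_or_one j with h | h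
    · simp [h, Nat.add_mod, hab]
    · simp [h, Nat.add_mod, hab.symm]
  let K := {p : Fin (s + 1) × Fin r // p.1 = 0 ∨ p.2 ≠ c (p.1 + 1)}
  let snd : K → Option (Fin (s + 1)) := fun p =>
    if h : p.1.2 = c p.1.1 ∧ (p.1.1 : ℕ) < s then some ⟨p.1.1 + 1, by omega⟩ else none
  have hsnd : ∀ {p y}, snd p = some y ↔ p.1.2 = c p.1.1 ∧ (y : ℕ) = p.1.1 + 1 := by
    intro p y
    simp only [snd]
    split_ifs with h
    · simp [h, Fin.ext_iff, eq_comm]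
    · simp only [false_iff]
      rintro ⟨h1, h2⟩
      exact h ⟨h1, by omega⟩
  refine ⟨{
    Var := Fin (s + 1)
    Clause := K
    finite_var := inferInstance
    finite_clause := inferInstance
    fst := fun p => p.1.1
    snd := snd
    col := fun p => p.1.2
    edge := fun y z => c (min (y : ℕ) z)
    edge_symm := fun y z => by rw [min_comm]
    edge_eq := fun {p y} h => ?_
    eq_of_fst_eq := fun h1 h2 => Subtype.ext (Prod.ext h2 h1)
    snd_ne := fun {p p'} h h' => ?_
    unsat := fun χ => ?_
    val := fun i y => if (y : ℕ) ≤ i then c y else c (y + 1)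
    eq_of_violated := ?_ }⟩
  · obtain ⟨h1, h2⟩ := hsnd.1 h
    rw [h1, h2, min_eq_left (Nat.le_succ _)]
  · obtain ⟨h1, h2⟩ := hsnd.1 h'
    rcases p.2 with h0 | hne
    · simp [h0] at h2
    · exact hne (by rw [h, h1, h2, hc2])
  · by_contra! hno
    have key : ∀ j (hj : j < s + 1), χ ⟨j, hj⟩ = c j := by
      intro j
      induction j with
      | zero =>
        intro hj
        by_contra hne
        obtain ⟨y, hy, -⟩ := hno ⟨(⟨0, hj⟩, χ ⟨0, hj⟩), .inl rfl⟩ rfl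
        exact hne (hsnd.1 hy).1
      | succ j ih =>
        intro hj
        have ih := ih (by omega)
        obtain ⟨y, hy, hyne⟩ := hno ⟨(⟨j, by omega⟩, c j), .inr (hc j)⟩ ih
        obtain rfl : y = ⟨j + 1, hj⟩ := Fin.ext (hsnd.1 hy).2
        by_contra hne
        obtain ⟨z, hz, -⟩ := hno ⟨(⟨j + 1, hj⟩, χ ⟨j + 1, hj⟩),
          .inr (by change _ ≠ c (j + 2); rw [hc2]; exact hyne)⟩ rfl
        exact hne (hsnd.1 hz).1
    obtain ⟨y, hy, -⟩ := hno ⟨(⟨s, by omega⟩, c s), .inr (hc s)⟩ (key s _)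
    have : (y : ℕ) = s + 1 := (hsnd.1 hy).2
    omega
  · have key : ∀ {i : Fin s} {p : K}, (if (p.1.1 : ℕ) ≤ i then c p.1.1 else c (p.1.1 + 1)) = p.1.2 →
        (∀ y, snd p = some y → (if (y : ℕ) ≤ i then c y else c (y + 1)) = p.1.2) →
        (p.1.1 : ℕ) = i := by
      intro i p h1 h2
      split_ifs at h1 with hle
      · by_contra hne
        have := h2 ⟨p.1.1 + 1, by omega⟩ (hsnd.2 ⟨h1.symm, rfl⟩)
        rw [if_pos (by simp only; omega), ← h1] at this
        exact hc _ this.symm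
      · rcases p.2 with h0 | hne
        · simp [h0] at hle
        · exact (hne h1.symm).elim
    intro i j p hi hi' hj hj'
    exact Fin.ext ((key hi hi').symm.trans (key hj hj'))

end Clauses

section Construction

variable {β : Type} {r s : ℕ}

/-- A gadget forcing two disjoint edges to have equal (`ε = true`) or distinct colours. -/
theorem exists_constraint_extension [Fintype β] {H : SimpleGraph β}
    (hH : ThreeChromaticallyConnected H) (hr : 2 ≤ r) (ε : Bool) :
    ∃ E : Extension twoEdges, ∀ γ : Sym2 (Bool × Bool) → Fin r, E.Realizes H γ ↔
      (γ s((false, false), (false, true)) = γ s((true, false), (true, true)) ↔ ε = true) := by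
  cases ε
  · obtain ⟨E, hE⟩ := exists_ne_extension (r := r) hH hr
    obtain ⟨E', hE'⟩ := exists_twoEdges_extension hH hr (R := (· ≠ ·)) (E := E)
      fun x => (hE x).trans ne_comm
    exact ⟨E', fun γ => (hE' γ).trans (by simp)⟩
  · obtain ⟨E, hE⟩ := exists_adjacent_eq_extension (r := r) hH hr
    obtain ⟨E', hE'⟩ := exists_twoEdges_extension hH hr (R := (· = ·)) (E := E)
      fun x => (hE x).trans eq_comm
    exact ⟨E', fun γ => (hE' γ).trans (by simp)⟩

/-- An injective endomorphism of a finite graph is surjective on edges. -/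
theorem exists_adj_of_injective_hom [Finite β] {H : SimpleGraph β} {h : β → β}
    (hinj : Function.Injective h) (hadj : ∀ {u w}, H.Adj u w → H.Adj (h u) (h w)) {a b : β}
    (hab : H.Adj a b) : ∃ u w, H.Adj u w ∧ h u = a ∧ h w = b := by
  let F : {d : β × β // H.Adj d.1 d.2} → {d : β × β // H.Adj d.1 d.2} :=
    fun d => ⟨(h d.1.1, h d.1.2), hadj d.2⟩
  have hF : Function.Injective F := by
    rintro ⟨⟨u, w⟩, hd⟩ ⟨⟨u', w'⟩, hd'⟩ heq
    simp only [F, Subtype.mk.injEq, Prod.mk.injEq] at heq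
    simp [hinj heq.1, hinj heq.2]
  obtain ⟨⟨⟨u, w⟩, hd⟩, heq⟩ := Finite.surjective_of_injective hF ⟨(a, b), hab⟩
  simp only [F, Subtype.mk.injEq, Prod.mk.injEq] at heq
  exact ⟨u, w, hd, heq⟩

section Core

/-- Vertices of the core: the reference edges `refL k`—`refR k`, one for each colour, and for
each clause `κ` a copy of `H` on the apex, the variables of `κ` and private vertices. -/
inductive CoreVertex (P : ClauseSystem r s) (β : Type) : Type
  | refL (k : Fin r)
  | refR (k : Fin r)
  | apex
  | var (y : P.Var)
  | priv (κ : P.Clause) (w : β)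

variable {P : ClauseSystem r s}

open CoreVertex

instance [Finite β] : Finite (CoreVertex P β) := by
  let f : (Fin r ⊕ Fin r) ⊕ Unit ⊕ P.Var ⊕ P.Clause × β → CoreVertex P β :=
    Sum.elim (Sum.elim refL refR) (Sum.elim (fun _ => apex) (Sum.elim var fun x => priv x.1 x.2))
  refine Finite.of_surjective f ?_
  rintro (k | k | _ | y | ⟨κ, w⟩)
  · exact ⟨.inl (.inl k), rfl⟩
  · exact ⟨.inl (.inr k), rfl⟩
  · exact ⟨.inr (.inl ()), rfl⟩
  · exact ⟨.inr (.inr (.inl y)), rfl⟩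
  · exact ⟨.inr (.inr (.inr (κ, w))), rfl⟩

variable {v p q : β}

open Classical in
/-- The copy of `H` of the clause `κ`: `v` is the apex, `p` and `q` are the variables. -/
noncomputable def place (P : ClauseSystem r s) (v p q : β) (κ : P.Clause) (w : β) :
    CoreVertex P β :=
  if w = v then apex else if w = p then var (P.fst κ)
  else if w = q then (P.snd κ).elim (priv κ q) var else priv κ w

theorem place_cases (P : ClauseSystem r s) (v p q : β) (κ : P.Clause) (w : β) :
    (w = v ∧ place P v p q κ w = apex) ∨ (w = p ∧ place P v p q κ w = var (P.fst κ)) ∨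
      (∃ y, w = q ∧ P.snd κ = some y ∧ place P v p q κ w = var y) ∨
      place P v p q κ w = priv κ w := by
  unfold place
  split_ifs with h1 h2 h3
  · exact .inl ⟨h1, rfl⟩
  · exact .inr (.inl ⟨h2, rfl⟩)
  · cases h : P.snd κ with
    | none => exact .inr (.inr (.inr (by rw [h3]; rfl)))
    | some y => exact .inr (.inr (.inl ⟨y, h3, rfl, rfl⟩))
  · exact .inr (.inr (.inr rfl))

theorem place_injective (κ : P.Clause) : Function.Injective (place P v p q κ) := by
  intro a b hab
  rcases place_cases P v p q κ a with ⟨h, h'⟩ | ⟨h, h'⟩ | ⟨y, h, hy, h'⟩ | h' <;>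
    rcases place_cases P v p q κ b with ⟨h₁, h₁'⟩ | ⟨h₁, h₁'⟩ | ⟨z, h₁, hz, h₁'⟩ | h₁' <;>
    rw [h', h₁'] at hab <;> first | (cases hab; done) | skip
  · rw [h, h₁]
  · rw [h, h₁]
  · exact (P.snd_ne rfl (hz.trans (by rw [var.inj hab]))).elim
  · exact (P.snd_ne rfl (hy.trans (by rw [var.inj hab]))).elim
  · rw [h, h₁]
  · exact (priv.inj hab).2

/-- Copies of `H` of distinct clauses of the same colour share only images of `v` and `q`. -/
theorem place_ne_place {κ κ' : P.Clause} (hκ : κ ≠ κ') (hcol : P.col κ = P.col κ') {u : β}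
    (hv : u ≠ v) (hq : u ≠ q) (w : β) : place P v p q κ u ≠ place P v p q κ' w := by
  intro h
  rcases place_cases P v p q κ u with ⟨hu, hu'⟩ | ⟨hu, hu'⟩ | ⟨y, hu, hy, hu'⟩ | hu' <;>
    rcases place_cases P v p q κ' w with ⟨hw, hw'⟩ | ⟨hw, hw'⟩ | ⟨z, hw, hz, hw'⟩ | hw' <;>
    rw [hu', hw'] at h <;>
    first
    | exact hv hu
    | exact hq hu
    | (cases h; done)
    | exact hκ (P.eq_of_fst_eq hcol (var.inj h))
    | exact P.snd_ne hcol (hz.trans (congrArg some (var.inj h).symm))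
    | exact hκ (priv.inj h).1

theorem place_eq_apex {κ : P.Clause} {u : β} : place P v p q κ u = apex ↔ u = v := by
  refine ⟨fun h => ?_, fun h => by simp [place, h]⟩
  rcases place_cases P v p q κ u with ⟨hu, hu'⟩ | ⟨hu, hu'⟩ | ⟨y, hu, hy, hu'⟩ | hu' <;>
    rw [hu'] at h <;> first | exact hu | cases h

theorem eq_or_eq_of_place_eq_var {κ : P.Clause} {u : β} {y : P.Var}
    (h : place P v p q κ u = var y) : u = p ∨ u = q := by
  rcases place_cases P v p q κ u with ⟨hu, hu'⟩ | ⟨hu, hu'⟩ | ⟨y, hu, hy, hu'⟩ | hu' <;>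
    rw [hu'] at h <;> first | exact .inl hu | exact .inr hu | cases h

/-- The core graph. -/
def coreGraph (P : ClauseSystem r s) (H : SimpleGraph β) (v p q : β) :
    SimpleGraph (CoreVertex P β) where
  Adj a b := (∃ k, s(a, b) = s(refL k, refR k)) ∨
    ∃ κ u w, H.Adj u w ∧ a = place P v p q κ u ∧ b = place P v p q κ w
  symm := ⟨by
    rintro a b (⟨k, h⟩ | ⟨κ, u, w, h, ha, hb⟩)
    · exact .inl ⟨k, Sym2.eq_swap.trans h⟩
    · exact .inr ⟨κ, w, u, h.symm, hb, ha⟩⟩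
  loopless := ⟨by
    rintro a (⟨k, h⟩ | ⟨κ, u, w, h, ha, hb⟩)
    · simp only [Sym2.eq_iff] at h
      rcases h with ⟨rfl, h⟩ | ⟨rfl, h⟩ <;> cases h
    · exact h.ne (place_injective κ (ha.symm.trans hb))⟩

variable {H : SimpleGraph β}

theorem coreGraph_adj_place {κ : P.Clause} {u w : β} (h : H.Adj u w) :
    (coreGraph P H v p q).Adj (place P v p q κ u) (place P v p q κ w) :=
  .inr ⟨κ, u, w, h, rfl, rfl⟩

theorem coreGraph_adj_ref (k : Fin r) : (coreGraph P H v p q).Adj (refL k) (refR k) :=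
  .inl ⟨k, rfl⟩

theorem place_ne_ref (κ : P.Clause) (w : β) (k : Fin r) :
    place P v p q κ w ≠ refL k ∧ place P v p q κ w ≠ refR k := by
  rcases place_cases P v p q κ w with ⟨-, h⟩ | ⟨-, h⟩ | ⟨y, -, -, h⟩ | h <;> rw [h] <;>
    exact ⟨by rintro ⟨⟩, by rintro ⟨⟩⟩

theorem coreGraph_adj_refL {k : Fin r} {a : CoreVertex P β} :
    (coreGraph P H v p q).Adj (refL k) a ↔ a = refR k := by
  constructor
  · rintro (⟨l, h⟩ | ⟨κ, u, w, -, h, -⟩)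
    · simp only [Sym2.eq_iff] at h
      rcases h with ⟨⟨⟩, rfl⟩ | ⟨⟨⟩, -⟩
      rfl
    · exact ((place_ne_ref κ u k).1 h.symm).elim
  · rintro rfl
    exact coreGraph_adj_ref k

theorem coreGraph_adj_refR {k : Fin r} {a : CoreVertex P β} :
    (coreGraph P H v p q).Adj (refR k) a ↔ a = refL k := by
  constructor
  · rintro (⟨l, h⟩ | ⟨κ, u, w, -, h, -⟩)
    · simp only [Sym2.eq_iff] at h
      rcases h with ⟨⟨⟩, -⟩ | ⟨⟨⟩, rfl⟩
      rfl
    · exact ((place_ne_ref κ u k).2 h.symm).elim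
  · rintro rfl
    exact (coreGraph_adj_ref k).symm

/-- A reference edge and another edge form an induced matching of the core. -/
def refFrame (k : Fin r) (a b : CoreVertex P β) (hab : (coreGraph P H v p q).Adj a b)
    (ha : a ≠ refL k ∧ a ≠ refR k) (hb : b ≠ refL k ∧ b ≠ refR k) :
    twoEdges ↪g coreGraph P H v p q where
  toFun x := if x.1 then (if x.2 then b else a) else (if x.2 then refR k else refL k)
  inj' := by
    rintro ⟨_ | _, _ | _⟩ ⟨_ | _, _ | _⟩ h <;>
      simp_all [hab.ne, hab.ne', ha.1.symm, ha.2.symm, hb.1.symm, hb.2.symm]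
  map_rel_iff' := by
    rintro ⟨i, j⟩ ⟨i', j'⟩
    change (coreGraph P H v p q).Adj (if i then (if j then b else a) else
      (if j then refR k else refL k)) (if i' then (if j' then b else a) else
      (if j' then refR k else refL k)) ↔ _
    have h : ∀ x, (coreGraph P H v p q).Adj x (refL k) ↔ x = refR k := fun x =>
      (SimpleGraph.adj_comm _ _ _).trans coreGraph_adj_refL
    have h' : ∀ x, (coreGraph P H v p q).Adj x (refR k) ↔ x = refL k := fun x =>
      (SimpleGraph.adj_comm _ _ _).trans coreGraph_adj_refR
    cases i <;> cases j <;> cases i' <;> cases j' <;>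
      simp [twoEdges, coreGraph_adj_refL, coreGraph_adj_refR, h, h', hab, hab.symm, ha, hb]

/-- The constraints on the colours of the core: reference edges get distinct colours, and the
edges of a clause that do not join the apex to a variable get the reference colour. -/
abbrev ConstraintIndex (P : ClauseSystem r s) (H : SimpleGraph β) (v p q : β) : Type :=
  {x : Fin r × Fin r // x.1 ≠ x.2} ⊕ {t : P.Clause × β × β // H.Adj t.2.1 t.2.2 ∧
    ∀ y, s(place P v p q t.1 t.2.1, place P v p q t.1 t.2.2) ≠ s(apex, var y)}

/-- The two edges compared by a constraint. -/
noncomputable def constraintFrame : ConstraintIndex P H v p q → (twoEdges ↪g coreGraph P H v p q)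
  | .inl x => refFrame x.1.1 (refL x.1.2) (refR x.1.2) (coreGraph_adj_ref _)
      ⟨fun h => x.2 (refL.inj h).symm, by rintro ⟨⟩⟩ ⟨by rintro ⟨⟩, fun h => x.2 (refR.inj h).symm⟩
  | .inr t => refFrame (P.col t.1.1) (place P v p q t.1.1 t.1.2.1) (place P v p q t.1.1 t.1.2.2)
      (coreGraph_adj_place t.2.1) (place_ne_ref _ _ _) (place_ne_ref _ _ _)

open Classical in
/-- The colours of the core for the assignment `χ`: the edge from the apex to a variable shows
its value, the other edges of the copy of `H` of a clause have its colour. -/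
noncomputable def coreColor [NeZero r] (χ : P.Var → Fin r) : Sym2 (CoreVertex P β) → Fin r :=
  Sym2.lift ⟨fun
    | apex, var y => χ y
    | var y, apex => χ y
    | var y, var z => P.edge y z
    | priv κ _, priv κ' _ => if κ = κ' then P.col κ else 0
    | priv κ _, _ => P.col κ
    | _, priv κ _ => P.col κ
    | refL k, refR _ => k
    | refR _, refL k => k
    | _, _ => 0, by
      rintro (_ | _ | _ | _ | _) (_ | _ | _ | _ | _) <;> try rfl
      · exact P.edge_symm _ _
      · simp only [eq_comm]
        split_ifs with h <;> simp [h] ⟩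

variable [NeZero r]

theorem coreColor_congr {χ χ' : P.Var → Fin r} {a b : CoreVertex P β}
    (h : a = apex ↔ b = apex) : coreColor χ s(a, b) = coreColor χ' s(a, b) := by
  rcases a with _ | _ | _ | _ | _ <;> rcases b with _ | _ | _ | _ | _ <;>
    first | rfl | (simp at h)

theorem coreColor_place (χ : P.Var → Fin r) {κ : P.Clause}
    {u w : β} (huw : H.Adj u w)
    (h : ∀ y, s(place P v p q κ u, place P v p q κ w) ≠ s(apex, var y)) :
    coreColor χ s(place P v p q κ u, place P v p q κ w) = P.col κ := by
  rcases place_cases P v p q κ u with ⟨hu, hu'⟩ | ⟨hu, hu'⟩ | ⟨y, hu, hy, hu'⟩ | hu' <;>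
    rcases place_cases P v p q κ w with ⟨hw, hw'⟩ | ⟨hw, hw'⟩ | ⟨z, hw, hz, hw'⟩ | hw' <;>
    rw [hu', hw'] at h ⊢ <;>
    first
    | rfl
    | exact (h _ rfl).elim
    | exact (h _ Sym2.eq_swap).elim
    | exact (huw.ne (hu.trans hw.symm)).elim
    | exact P.edge_eq hz
    | exact (P.edge_symm _ _).trans (P.edge_eq hy)
    | exact if_pos rfl

/-- In a copy of `H` of a clause, the edges of the core of its colour are edges of the copy. -/
theorem adj_of_coreGraph_adj_place (hvp : H.Adj v p) (hvq : H.Adj v q) {χ : P.Var → Fin r}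
    {κ : P.Clause} {u w : β} (h : (coreGraph P H v p q).Adj (place P v p q κ u) (place P v p q κ w))
    (hcol : coreColor χ s(place P v p q κ u, place P v p q κ w) = P.col κ) : H.Adj u w := by
  have hne : u ≠ w := fun huw => h.ne (by rw [huw])
  obtain ⟨l, hl⟩ | ⟨κ', u', w', huw', hu', hw'⟩ := h
  · simp [place_ne_ref] at hl
  by_cases hκ : κ = κ'
  · subst hκ
    rwa [place_injective κ hu', place_injective κ hw']
  by_cases hy : ∃ y, s(place P v p q κ u, place P v p q κ w) = s(apex, var y)
  · obtain ⟨y, hy⟩ := hy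
    rcases Sym2.eq_iff.1 hy with ⟨h1, h2⟩ | ⟨h1, h2⟩
    · rw [place_eq_apex.1 h1]
      rcases eq_or_eq_of_place_eq_var h2 with rfl | rfl <;> assumption
    · rw [place_eq_apex.1 h2]
      rcases eq_or_eq_of_place_eq_var h1 with rfl | rfl <;> exact SimpleGraph.Adj.symm ‹_›
  · push Not at hy
    have hcol' : P.col κ = P.col κ' := by
      rw [← hcol, hu', hw']
      exact coreColor_place χ huw' (by rwa [← hu', ← hw'])
    have hu : u = v ∨ u = q := by
      by_contra! hu
      exact place_ne_place hκ hcol' hu.1 hu.2 _ hu'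
    have hw : w = v ∨ w = q := by
      by_contra! hw
      exact place_ne_place hκ hcol' hw.1 hw.2 _ hw'
    rcases hu with rfl | rfl <;> rcases hw with rfl | rfl
    · exact (hne rfl).elim
    · exact hvq
    · exact hvq.symm
    · exact (hne rfl).elim

variable [Fintype β]

/-- A copy of `H` in the core contains no reference vertex. -/
theorem exists_place_of_hom (hH : ThreeChromaticallyConnected H) {g : β → CoreVertex P β}
    (hg : ∀ {u w}, H.Adj u w → (coreGraph P H v p q).Adj (g u) (g w)) {u w : β} (huw : H.Adj u w) :
    ∃ κ u' w', H.Adj u' w' ∧ g u = place P v p q κ u' ∧ g w = place P v p q κ w' := by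
  have h := hom_localized hH hg (Set.range refL ∪ Set.range refR) ∅ (fun _ => true)
    (by simp) (by
      rintro _ (⟨k, rfl⟩ | ⟨k, rfl⟩) b hb - h
      · exact hb (.inr ⟨k, (coreGraph_adj_refL.1 h).symm⟩)
      · exact hb (.inl ⟨k, (coreGraph_adj_refR.1 h).symm⟩))
  obtain ⟨l, hl⟩ | hplace := hg huw
  · exfalso
    rcases h with h | h
    · simp only [Sym2.eq_iff] at hl
      rcases hl with ⟨hl, -⟩ | ⟨hl, -⟩
      · exact h u (.inl ⟨l, hl.symm⟩)
      · exact h u (.inr ⟨l, hl.symm⟩)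
    · classical
      refine not_two_colorable hH (fun u => decide (g u ∈ Set.range refL)) fun a b hab => ?_
      have hab := hg hab
      rcases h a with (⟨k, hk⟩ | ⟨k, hk⟩) | h
      · rw [← hk, coreGraph_adj_refL] at hab
        simp [← hk, hab]
      · rw [← hk, coreGraph_adj_refR] at hab
        simp [← hk, hab]
      · exact h.elim
  · exact hplace

/-- A copy of `H` in the core is not monochromatic for two different assignments. -/
theorem eq_of_isMono_coreColor (hH : ThreeChromaticallyConnected H) (hvp : H.Adj v p)
    (hvq : H.Adj v q) (hpq : p ≠ q) {i j : Fin s} {g : β → CoreVertex P β} {k : Fin r}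
    (hi : IsMono H (coreGraph P H v p q) (coreColor (P.val i)) g k)
    (hj : IsMono H (coreGraph P H v p q) (coreColor (P.val j)) g k) : i = j := by
  classical
  let G : SimpleGraph (CoreVertex P β) :=
    { Adj a b := (coreGraph P H v p q).Adj a b ∧ coreColor (P.val i) s(a, b) = k
      symm := ⟨fun a b h => ⟨h.1.symm, by rw [Sym2.eq_swap]; exact h.2⟩⟩
      loopless := ⟨fun a h => h.1.ne rfl⟩ }
  have hlocal : ∀ κ, P.col κ = k →
      (∀ u, g u ∈ place P v p q κ '' {v, q}ᶜ → g u ∈ place P v p q κ '' {v, q}) ∨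
        ∀ u, g u ∈ place P v p q κ '' {v, q}ᶜ ∨ g u ∈ place P v p q κ '' {v, q} := by
    intro κ hκ
    refine hom_localized hH (G := G) (fun huw => ⟨hi.adj huw, hi.col huw⟩) _ _
      (fun a => decide (a = apex)) ?_ ?_
    · rintro _ ⟨a, ha | ha, rfl⟩ _ ⟨b, hb | hb, rfl⟩ h
      · exact (h.1.ne (by rw [ha, hb])).elim
      · simp [place_eq_apex, ha, show b = q from hb, hvq.ne']
      · simp [place_eq_apex, hb, show a = q from ha, hvq.ne']
      · exact (h.1.ne (by rw [ha, show b = q from hb])).elim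
    · rintro _ ⟨u, hu, rfl⟩ b hb hb' ⟨h, hcol⟩
      have hb : ∀ w, b ≠ place P v p q κ w := by
        rintro w rfl
        by_cases hw : w ∈ ({v, q} : Set β)
        · exact hb' ⟨w, hw, rfl⟩
        · exact hb ⟨w, hw, rfl⟩
      obtain ⟨l, hl⟩ | ⟨κ', u', w', huw', hu', hw'⟩ := h
      · simp [place_ne_ref] at hl
      · simp only [Set.mem_compl_iff, Set.mem_insert_iff, Set.mem_singleton_iff, not_or] at hu
        refine place_ne_place (p := p) (κ' := κ') ?_ ?_ hu.1 hu.2 u' hu'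
        · rintro rfl
          exact hb w' hw'
        · rw [hκ, ← hcol, hu', hw']
          refine coreColor_place (P.val i) huw' fun y hy => ?_
          rw [← hu', ← hw'] at hy
          rcases Sym2.eq_iff.1 hy with ⟨h1, -⟩ | ⟨-, h1⟩
          · exact hu.1 (place_eq_apex.1 h1)
          · exact hb v (h1.trans (place_eq_apex.2 rfl).symm)
  obtain ⟨κ, hκ, u₀, hu₀⟩ : ∃ κ, P.col κ = k ∧ ∃ u, g u ∈ place P v p q κ '' {v, q}ᶜ := by
    by_contra! hno
    refine not_two_colorable hH (fun u => decide (g u = apex)) fun u w huw => ?_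
    obtain ⟨κ, u', w', huw', hu', hw'⟩ := exists_place_of_hom hH hi.adj huw
    by_cases hu : u' = v
    · have hw : w' ≠ v := fun hw => huw'.ne (hu.trans hw.symm)
      simp [hu', hw', place_eq_apex, hu, hw]
    by_cases hw : w' = v
    · simp [hu', hw', place_eq_apex, hu, hw]
    exfalso
    have hκ : P.col κ = k := by
      rw [← hi.col huw, hu', hw']
      refine (coreColor_place _ huw' fun y hy => ?_).symm
      rcases Sym2.eq_iff.1 hy with ⟨h1, -⟩ | ⟨-, h1⟩
      · exact hu (place_eq_apex.1 h1)
      · exact hw (place_eq_apex.1 h1)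
    by_cases huq : u' = q
    · exact hno κ hκ w ⟨w', by simp [hw, ← huq, huw'.ne'], hw'.symm⟩
    · exact hno κ hκ u ⟨u', by simp [hu, huq], hu'.symm⟩
  have hrange : ∀ u, ∃ u', g u = place P v p q κ u' := by
    rcases hlocal κ hκ with h | h
    · obtain ⟨a, ha, ha'⟩ := h u₀ hu₀
      obtain ⟨b, hb, hb'⟩ := hu₀
      exact (hb (place_injective κ (hb'.trans ha'.symm) ▸ ha)).elim
    · intro u
      rcases h u with ⟨a, -, ha⟩ | ⟨a, -, ha⟩ <;> exact ⟨a, ha.symm⟩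
  choose h hh using hrange
  have hinj : Function.Injective h := fun a b hab => hi.inj (by rw [hh, hh, hab])
  have hadj : ∀ {u w}, H.Adj u w → H.Adj (h u) (h w) := fun {u w} huw =>
    adj_of_coreGraph_adj_place hvp hvq (χ := P.val i) (κ := κ)
      (by rw [← hh, ← hh]; exact hi.adj huw) (by rw [← hh, ← hh, hκ]; exact hi.col huw)
  have hcol : ∀ {a b}, H.Adj a b →
      coreColor (P.val i) s(place P v p q κ a, place P v p q κ b) = k ∧
        coreColor (P.val j) s(place P v p q κ a, place P v p q κ b) = k := by
    intro a b hab
    obtain ⟨u, w, huw, rfl, rfl⟩ := exists_adj_of_injective_hom hinj hadj hab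
    rw [← hh, ← hh]
    exact ⟨hi.col huw, hj.col huw⟩
  have hv : place P v p q κ v = apex := place_eq_apex.2 rfl
  have hp : place P v p q κ p = var (P.fst κ) := by simp [place, hvp.ne']
  have hq : ∀ y, P.snd κ = some y → place P v p q κ q = var y := fun y hy => by
    simp [place, hvq.ne', hpq.symm, hy]
  have hfst := hcol hvp
  rw [hv, hp] at hfst
  have hsnd : ∀ y, P.snd κ = some y → P.val i y = k ∧ P.val j y = k := fun y hy => by
    have h := hcol hvq
    rwa [hv, hq y hy] at h
  subst hκ
  exact P.eq_of_violated hfst.1 (fun y hy => (hsnd y hy).1) hfst.2 fun y hy => (hsnd y hy).2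

end Core

open CoreVertex in
/-- The graph is the core with gadgets enforcing the constraints. -/
theorem exists_blowup_dependence_of_type [Fintype β] {H : SimpleGraph β}
    (hH : ThreeChromaticallyConnected H) (hr : 2 ≤ r)
    (hs : 2 ≤ s) : ∃ (V : Type) (_ : Finite V) (G : SimpleGraph V), Arrows G H r ∧
      ∃ c : Sym2 (V × Fin s) → Fin r, ¬ HasMonoCanonCopy G H s 2 r c := by
  obtain ⟨P⟩ := nonempty_clauseSystem hr s
  obtain ⟨v, p, hvp⟩ := exists_adj hH
  obtain ⟨q, hqp, hvq⟩ := exists_other_neighbor hH hvp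
  choose gadget hgadget using exists_constraint_extension (r := r) hH hr
  let E : ConstraintIndex P H v p q → Extension twoEdges := fun t => gadget (Sum.isRight t)
  have hcon : ∀ γ : Sym2 (CoreVertex P β) → Fin r,
      (∀ t, (E t).Realizes H (γ ∘ Sym2.map (constraintFrame t))) ↔
      (∀ k l, k ≠ l → γ s(refL k, refR k) ≠ γ s(refL l, refR l)) ∧
      ∀ κ u w, H.Adj u w → (∀ y, s(place P v p q κ u, place P v p q κ w) ≠ s(apex, var y)) →
        γ s(place P v p q κ u, place P v p q κ w) = γ s(refL (P.col κ), refR (P.col κ)) := by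
    intro γ
    constructor
    · intro h
      refine ⟨fun k l hkl => ?_, fun κ u w huw hy => ?_⟩
      · have := (hgadget _ _).1 (h (.inl ⟨(k, l), hkl⟩))
        simpa [constraintFrame, refFrame] using this
      · have := (hgadget _ _).1 (h (.inr ⟨(κ, u, w), huw, hy⟩))
        exact (this.2 rfl).symm
    · rintro ⟨h1, h2⟩ (⟨⟨k, l⟩, hkl⟩ | ⟨⟨κ, u, w⟩, huw, hy⟩)
      · exact (hgadget _ _).2 ⟨fun h => (h1 k l hkl h).elim, fun h => by cases h⟩
      · exact (hgadget _ _).2 ⟨fun _ => rfl, fun _ => (h2 κ u w huw hy).symm⟩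
  let X := glue constraintFrame E
  refine ⟨CoreVertex P β ⊕ X.Inner, inferInstance, X.graph, ?_, ?_⟩
  · rw [arrows_iff]
    intro c hc
    have hX : X.Realizes H (c ∘ Sym2.map .inl) := ⟨c, hc, fun _ => rfl⟩
    obtain ⟨hne, heq⟩ := (hcon _).1 hX.of_glue
    let d : Fin r → Fin r := fun k => c s(.inl (refL k), .inl (refR k))
    have hd : Function.Injective d := fun k l h => by
      by_contra hkl
      exact hne k l hkl h
    let π := Equiv.ofBijective d (Finite.injective_iff_bijective.1 hd)
    obtain ⟨κ, h1, h2⟩ := P.unsat fun y => π.symm (c s(.inl apex, .inl (var y)))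
    have h3 : ∀ y, (∃ u, u ≠ v ∧ place P v p q κ u = var y) →
        c s(.inl apex, .inl (var y)) = d (P.col κ) := by
      rintro y ⟨u, hu, hy⟩
      rcases place_cases P v p q κ u with ⟨hu, hu'⟩ | ⟨hu, hu'⟩ | ⟨z, hu, hz, hu'⟩ | hu' <;>
        rw [hu'] at hy
      · cases hy
      · obtain rfl := var.inj hy
        exact π.symm_apply_eq.1 h1
      · obtain rfl := var.inj hy
        exact π.symm_apply_eq.1 (h2 _ hz)
      · cases hy
    refine hc (fun u => .inl (place P v p q κ u)) (d (P.col κ))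
      ⟨Sum.inl_injective.comp (place_injective κ), fun huw => X.adj_inl.2 (coreGraph_adj_place huw),
        fun {u w} huw => ?_⟩
    by_cases hy : ∃ y, s(place P v p q κ u, place P v p q κ w) = s(apex, var y)
    · obtain ⟨y, hy⟩ := hy
      rcases Sym2.eq_iff.1 hy with ⟨hu, hw⟩ | ⟨hu, hw⟩
      · rw [hu, hw]
        exact h3 y ⟨w, fun h => huw.ne ((place_eq_apex.1 hu).trans h.symm), hw⟩
      · rw [hu, hw, Sym2.eq_swap]
        exact h3 y ⟨u, fun h => huw.ne (h.trans (place_eq_apex.1 hw).symm), hu⟩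
    · push Not at hy
      exact heq κ u w huw hy
  · have : NeZero r := ⟨by omega⟩
    have hframe : ∀ χ : P.Var → Fin r, ∀ t,
        (E t).Realizes H (coreColor χ ∘ Sym2.map (constraintFrame t)) := fun χ =>
      (hcon _).2 ⟨fun _ _ h => h, fun _ _ _ huw hy => coreColor_place χ huw hy⟩
    have hχ : ∀ χ χ' : P.Var → Fin r, ∀ (t : ConstraintIndex P H v p q) a b, twoEdges.Adj a b →
        coreColor χ s(constraintFrame t a, constraintFrame t b) =
          coreColor χ' s(constraintFrame t a, constraintFrame t b) := by
      rintro χ χ' (⟨⟨k, l⟩, hkl⟩ | ⟨⟨κ, u, w⟩, huw, hy⟩) ⟨_ | _, _ | _⟩ ⟨_ | _, _ | _⟩ hab <;>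
        simp only [twoEdges, ne_eq, not_true_eq_false, and_false, reduceCtorEq, false_and] at hab
      iterate 6 rfl
      · exact (coreColor_place χ huw hy).trans (coreColor_place χ' huw hy).symm
      · rw [Sym2.eq_swap]
        exact (coreColor_place χ huw hy).trans (coreColor_place χ' huw hy).symm
    let i₀ : Fin s := ⟨0, by omega⟩
    obtain ⟨D, hD, hD', hcore⟩ := exists_glue_extend hH (fun _ => twoEdgesColoring)
      (coreColor (P.val i₀)) (hframe _)
    refine exists_blowup_color hs (.inl apex) (fun i => D (coreColor (P.val i))) ?_ ?_
    · rintro i j (a | a) (b | b) h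
      · simp only [hD]
        exact coreColor_congr (by simpa using h)
      · exact hD' _ _ _ _
      · rw [Sym2.eq_swap]
        exact hD' _ _ _ _
      · exact hD' _ _ _ _
    · intro i j f k hij hi hj
      choose g hg using hcore _ (fun t a b => hχ _ _ t a b) f k hi
      have key : ∀ l, IsMono H X.graph (D (coreColor (P.val l))) f k →
          IsMono H (coreGraph P H v p q) (coreColor (P.val l)) g k := fun l hl =>
        have := Extension.isMono_core hl hg
        ⟨this.inj, this.adj, fun huw => (hD _ _ _).symm.trans (this.col huw)⟩
      exact hij (eq_of_isMono_coreColor hH hvp hvq hqp.symm (key i hi) (key j hj))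

end Construction

section Transport

universe u₁ u₂ u₃ u₄

variable {α : Type u₁} {α' : Type u₂} {β : Type u₃} {β' : Type u₄} {G : SimpleGraph α}
  {G' : SimpleGraph α'} {H : SimpleGraph β} {H' : SimpleGraph β'} {r s : ℕ}

theorem threeChromaticallyConnected_of_iso [Fintype β] [Fintype β'] (e : H ≃g H')
    (hH : ThreeChromaticallyConnected H) : ThreeChromaticallyConnected H' := by
  refine ⟨Fintype.card_congr e.toEquiv ▸ hH.1, fun t ht => ?_⟩
  have h : ∀ t : Set β', Nonempty (H.induce (e ⁻¹' t) ≃g H'.induce t) := fun t =>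
    ⟨{ toEquiv := e.toEquiv.subtypeEquiv fun _ => Iff.rfl
       map_rel_iff' := e.map_rel_iff }⟩
  obtain ⟨φ⟩ := h t
  obtain ⟨ψ⟩ := h tᶜ
  exact ψ.connected_iff.1 (hH.2 _ (ht.of_hom φ.toHom))

theorem arrows_of_iso (eG : G ≃g G') (eH : H ≃g H') (h : Arrows G H r) : Arrows G' H' r := by
  intro c
  obtain ⟨f, hf, k, hk⟩ := h (c ∘ Sym2.map eG)
  refine ⟨eG ∘ f ∘ eH.symm, eG.injective.comp (hf.comp eH.symm.injective), k, fun u v huv => ?_⟩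
  obtain ⟨h1, h2⟩ := hk _ _ (eH.symm.map_rel_iff.2 huv)
  exact ⟨eG.map_rel_iff.2 h1, h2⟩

theorem hasMonoCanonCopy_of_iso (eG : G ≃g G') (eH : H ≃g H') {t : ℕ}
    {c : Sym2 (α × Fin s) → Fin r} (h : HasMonoCanonCopy G' H' s t r
      (c ∘ Sym2.map (Prod.map eG.symm id))) : HasMonoCanonCopy G H s t r c := by
  obtain ⟨f, hf, g, hg, k, hk⟩ := h
  refine ⟨eG.symm ∘ f ∘ eH, eG.symm.injective.comp (hf.comp eH.injective), fun u => g (eH u),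
    fun u => hg _, k, fun u v huv => ?_⟩
  obtain ⟨h1, h2⟩ := hk _ _ (eH.map_rel_iff.2 huv)
  exact ⟨eG.symm.map_rel_iff.2 h1, h2⟩

end Transport

end BlowupRamsey

/-- For every `3`-chromatically connected graph `H`, every `r ≥ 2` and every
`s ≥ 2` there is a graph `G` with `G →ᵣ H`, but some `r`-colouring of the
edges of the `s`-blowup `G[s]` has no monochromatic canonical copy of `H[2]`. -/
theorem three_chromatically_connected_blowup_dependence
    {β : Type*} [Fintype β] (H : SimpleGraph β)
    (hH : ThreeChromaticallyConnected H) (r : ℕ) (hr : 2 ≤ r) (s : ℕ) (hs : 2 ≤ s) :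
    ∃ (N : ℕ) (G : SimpleGraph (Fin N)),
      Arrows G H r ∧
      ∃ c : Sym2 (Fin N × Fin s) → Fin r, ¬ HasMonoCanonCopy G H s 2 r c := by
  let e := Fintype.equivFin β
  let eH : H ≃g H.map e.toEmbedding := SimpleGraph.Iso.map e H
  obtain ⟨V, hV, G, hG, c, hc⟩ :=
    BlowupRamsey.exists_blowup_dependence_of_type
      (BlowupRamsey.threeChromaticallyConnected_of_iso eH hH) hr hs
  obtain ⟨N, ⟨eV⟩⟩ := Finite.exists_equiv_fin V
  let eG : G ≃g G.map eV.toEmbedding := SimpleGraph.Iso.map eV G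
  exact ⟨N, _, BlowupRamsey.arrows_of_iso eG eH.symm hG, _, fun h =>
    hc (BlowupRamsey.hasMonoCanonCopy_of_iso eG eH.symm h)⟩
end
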